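/- arXiv:2601.07544 — 3 statements merged into one kernel-verified Lean document; each statement's English description precedes it below -/
import Mathlib

section
/- For any full passport (S, wt) with N = |S|, the number of positive tree permutations satisfies |PT_+| = Σ_{𝔭 ∈ 𝔓} (−1)^{|𝔭|−1} (N−1)^{|𝔭|−1} X(𝔭), where the sum ranges over all partitions of S into nonempty zero-sum blocks. -/
open Finset

/-- Cumulative sums of a permutation (linear ordering) of a finite subset `B`
with respect to the weight `wt`: `cumSumOn wt B P i = H_i`. -/
noncomputable def cumSumOn {α : Type*} (wt : α → ℝ) (B : Finset α)
    (P : Fin B.card ≃ {x // x ∈ B}) (i : ℕ) : ℝ :=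
  ∑ j ∈ Finset.univ.filter (fun j : Fin B.card => (j : ℕ) < i), wt (P j : α)

/-- A positive permutation of `B`: all proper cumulative sums are positive. -/
def PosPermOn {α : Type*} (wt : α → ℝ) (B : Finset α)
    (P : Fin B.card ≃ {x // x ∈ B}) : Prop :=
  ∀ i, 1 ≤ i → i ≤ B.card - 1 → 0 < cumSumOn wt B P i

/-- A tree permutation of `B`: (1) `H_i ≠ 0` for `1 ≤ i ≤ |B|-1`;
(2) whenever `H_{k-1} = H_l > 0` (`1 ≤ k < l ≤ |B|`), `min{H_k,…,H_{l-1}} < H_l`;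
(3) whenever `H_{k-1} = H_l < 0` (`1 ≤ k < l ≤ |B|`), `max{H_k,…,H_{l-1}} > H_l`. -/
def TreePermOn {α : Type*} (wt : α → ℝ) (B : Finset α)
    (P : Fin B.card ≃ {x // x ∈ B}) : Prop :=
  (∀ i, 1 ≤ i → i ≤ B.card - 1 → cumSumOn wt B P i ≠ 0) ∧
  (∀ k l, 1 ≤ k → k < l → l ≤ B.card →
    cumSumOn wt B P (k - 1) = cumSumOn wt B P l → 0 < cumSumOn wt B P l →
    ∃ t, k ≤ t ∧ t < l ∧ cumSumOn wt B P t < cumSumOn wt B P l) ∧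
  (∀ k l, 1 ≤ k → k < l → l ≤ B.card →
    cumSumOn wt B P (k - 1) = cumSumOn wt B P l → cumSumOn wt B P l < 0 →
    ∃ t, k ≤ t ∧ t < l ∧ cumSumOn wt B P l < cumSumOn wt B P t)

/-- `|P_+(B, wt)|`: the number of positive permutations of `B`. -/
noncomputable def numPos {α : Type*} (wt : α → ℝ) (B : Finset α) : ℕ :=
  Nat.card {P : Fin B.card ≃ {x // x ∈ B} // PosPermOn wt B P}

/-- `|PT_+(B, wt)|`: the number of positive tree permutations of `B`. -/
noncomputable def numPosTree {α : Type*} (wt : α → ℝ) (B : Finset α) : ℕ :=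
  Nat.card {P : Fin B.card ≃ {x // x ∈ B} // PosPermOn wt B P ∧ TreePermOn wt B P}

/-- `𝔭` is a partition of `S'` into nonempty zero-sum blocks. -/
def IsPart {α : Type*} (wt : α → ℝ) (S' : Finset α) (𝔭 : Finset (Finset α)) : Prop :=
  (∀ B ∈ 𝔭, B.Nonempty) ∧ (∀ B ∈ 𝔭, B ⊆ S') ∧
  (∀ a ∈ S', ∃! B, B ∈ 𝔭 ∧ a ∈ B) ∧ (∀ B ∈ 𝔭, ∑ s ∈ B, wt s = 0)

/-- `X(𝔭) = ∏_{B ∈ 𝔭} (|B| - 1)!`. -/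
def Xval {α : Type*} (𝔭 : Finset (Finset α)) : ℕ :=
  ∏ B ∈ 𝔭, Nat.factorial (B.card - 1)

namespace TreePassport

open Classical

variable {α : Type*}

/-- The lists enumerating the elements of `S` without repetition. -/
noncomputable def orderings (S : Finset α) : Finset (List α) := S.val.lists.toFinset

lemma mem_orderings {S : Finset α} {l : List α} :
    l ∈ orderings S ↔ l.Nodup ∧ ∀ a, a ∈ l ↔ a ∈ S := by
  rw [orderings, Multiset.mem_toFinset, Multiset.mem_lists_iff]
  constructor
  · intro h
    refine ⟨?_, fun a => ?_⟩
    · have := S.nodup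
      rw [h] at this
      exact Multiset.coe_nodup.1 this
    · rw [← Finset.mem_val, h]
      exact Multiset.mem_coe.symm
  · rintro ⟨h1, h2⟩
    exact (Multiset.Nodup.ext S.nodup (Multiset.coe_nodup.2 h1)).2 fun a => by
      exact (h2 a).symm

lemma length_of_mem_orderings {S : Finset α} {l : List α} (h : l ∈ orderings S) :
    l.length = S.card := by
  rw [mem_orderings] at h
  rw [← List.toFinset_card_of_nodup h.1]
  congr 1
  ext a
  simp [h.2]

lemma orderings_empty : orderings (∅ : Finset α) = {[]} := by
  ext l
  rw [mem_orderings, Finset.mem_singleton]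
  constructor
  · rintro ⟨-, h⟩
    exact List.eq_nil_iff_forall_not_mem.2 fun a ha => by simpa using (h a).1 ha
  · rintro rfl
    simp

lemma cons_mem_orderings {S : Finset α} {c : α} {l : List α} :
    c :: l ∈ orderings S ↔ c ∈ S ∧ l ∈ orderings (S.erase c) := by
  simp only [mem_orderings, List.nodup_cons, List.mem_cons, Finset.mem_erase]
  constructor
  · rintro ⟨⟨h1, h2⟩, h3⟩
    refine ⟨(h3 c).1 (Or.inl rfl), h2, fun a => ⟨fun ha => ⟨?_, (h3 a).1 (Or.inr ha)⟩, ?_⟩⟩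
    · rintro rfl
      exact h1 ha
    · rintro ⟨h4, h5⟩
      exact ((h3 a).2 h5).resolve_left h4
  · rintro ⟨h1, h2, h3⟩
    refine ⟨⟨fun h => ((h3 c).1 h).1 rfl, h2⟩, fun a => ?_⟩
    by_cases hac : a = c
    · simp [hac, h1]
    · simp [hac, h3]

/-- The sum of `f` over all orderings of `S`. -/
noncomputable def lsum (f : List α → ℤ) (S : Finset α) : ℤ := ∑ l ∈ orderings S, f l

lemma lsum_congr {f g : List α → ℤ} {S : Finset α} (h : ∀ l ∈ orderings S, f l = g l) :
    lsum f S = lsum g S := Finset.sum_congr rfl h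

lemma lsum_zero (S : Finset α) : lsum (fun _ => 0) S = 0 := Finset.sum_const_zero

lemma lsum_add (f g : List α → ℤ) (S : Finset α) :
    lsum (fun l => f l + g l) S = lsum f S + lsum g S := Finset.sum_add_distrib

lemma lsum_sum {ι : Type*} (s : Finset ι) (f : ι → List α → ℤ) (S : Finset α) :
    lsum (fun l => ∑ i ∈ s, f i l) S = ∑ i ∈ s, lsum (f i) S := Finset.sum_comm

lemma lsum_const_mul (a : ℤ) (f : List α → ℤ) (S : Finset α) :
    lsum (fun l => a * f l) S = a * lsum f S := (Finset.mul_sum _ _ _).symm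

lemma lsum_mul_const (a : ℤ) (f : List α → ℤ) (S : Finset α) :
    lsum (fun l => f l * a) S = lsum f S * a := (Finset.sum_mul _ _ _).symm

lemma lsum_cons (f : List α → ℤ) (S : Finset α) :
    lsum f S = (if S = ∅ then f [] else 0) +
      ∑ c ∈ S, lsum (fun l => f (c :: l)) (S.erase c) := by
  by_cases hS : S = ∅
  · subst hS
    simp [lsum, orderings_empty]
  · rw [if_neg hS, zero_add]
    unfold lsum
    rw [Finset.sum_sigma']
    symm
    refine Finset.sum_bij (fun p _ => p.1 :: p.2) ?_ ?_ ?_ ?_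
    · rintro ⟨c, l⟩ h
      rw [Finset.mem_sigma] at h
      exact cons_mem_orderings.2 h
    · rintro ⟨c, l⟩ - ⟨c', l'⟩ - h
      simp only [List.cons.injEq] at h
      obtain ⟨rfl, rfl⟩ := h
      rfl
    · rintro (_ | ⟨c, l⟩) h
      · refine absurd ?_ hS
        rw [mem_orderings] at h
        exact Finset.eq_empty_of_forall_notMem fun a ha => by simpa using (h.2 a).2 ha
      · exact ⟨⟨c, l⟩, Finset.mem_sigma.2 (cons_mem_orderings.1 h), rfl⟩
    · intros
      rfl

lemma sum_powerset_sum_mem {M : Type*} [AddCommMonoid M] (S : Finset α) (g : α → Finset α → M) :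
    ∑ B ∈ S.powerset, ∑ c ∈ B, g c (B.erase c) =
      ∑ c ∈ S, ∑ B ∈ (S.erase c).powerset, g c B := by
  rw [Finset.sum_sigma', Finset.sum_sigma']
  refine Finset.sum_bij' (fun p _ => ⟨p.2, p.1.erase p.2⟩) (fun p _ => ⟨insert p.1 p.2, p.1⟩)
    ?_ ?_ ?_ ?_ ?_
  · rintro ⟨B, c⟩ h
    simp only [Finset.mem_sigma, Finset.mem_powerset] at h ⊢
    exact ⟨h.1 h.2, Finset.erase_subset_erase _ h.1⟩
  · rintro ⟨c, B⟩ h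
    simp only [Finset.mem_sigma, Finset.mem_powerset] at h ⊢
    exact ⟨Finset.insert_subset h.1 (h.2.trans (Finset.erase_subset _ _)),
      Finset.mem_insert_self _ _⟩
  · rintro ⟨B, c⟩ h
    simp only [Finset.mem_sigma] at h
    simp [Finset.insert_erase h.2]
  · rintro ⟨c, B⟩ h
    simp only [Finset.mem_sigma, Finset.mem_powerset] at h
    have : c ∉ B := fun hc => by simpa using h.2 hc
    simp [Finset.erase_insert this]
  · intros
    rfl

/-- The sum of `h u v` over all ways to write a list as a concatenation `u ++ v`. -/
def csum (h : List α → List α → ℤ) : List α → ℤ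
  | [] => h [] []
  | a :: l => h [] (a :: l) + csum (fun u v => h (a :: u) v) l

lemma csum_eq_sum (h : List α → List α → ℤ) (l : List α) :
    csum h l = ∑ i ∈ Finset.range (l.length + 1), h (l.take i) (l.drop i) := by
  induction l generalizing h with
  | nil => simp [csum]
  | cons a l ih =>
    rw [csum, ih, List.length_cons, Finset.sum_range_succ' _ (l.length + 1)]
    simp [add_comm]

/-- Cutting an ordering of `S` in two pieces amounts to splitting `S` in two and ordering
both parts. -/
lemma lsum_csum (h : List α → List α → ℤ) (S : Finset α) :
    lsum (csum h) S = ∑ B ∈ S.powerset, lsum (fun u => lsum (h u) (S \ B)) B := by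
  induction S using Finset.strongInduction generalizing h with
  | H S ih =>
  have hR : ∑ B ∈ S.powerset, lsum (fun u => lsum (h u) (S \ B)) B = lsum (h []) S +
      ∑ c ∈ S, ∑ B ∈ (S.erase c).powerset,
        lsum (fun u => lsum (h (c :: u)) (S.erase c \ B)) B := by
    rw [← sum_powerset_sum_mem S fun c B => lsum (fun u => lsum (h (c :: u)) (S.erase c \ B)) B]
    have h1 : ∀ B ∈ S.powerset, lsum (fun u => lsum (h u) (S \ B)) B =
        (if B = ∅ then lsum (h []) S else 0) +
          ∑ c ∈ B, lsum (fun u => lsum (h (c :: u)) (S.erase c \ B.erase c)) (B.erase c) := by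
      intro B _
      rw [lsum_cons]
      congr 1
      · split_ifs with hB
        · simp [hB]
        · rfl
      · refine Finset.sum_congr rfl fun c hc => ?_
        have : S.erase c \ B.erase c = S \ B := by
          ext a
          by_cases hac : a = c
          · simp [hac, hc]
          · simp [hac]
        rw [this]
    rw [Finset.sum_congr rfl h1, Finset.sum_add_distrib]
    simp
  rw [hR, lsum_cons (csum h), lsum_cons (h []), add_assoc, ← Finset.sum_add_distrib]
  congr 1
  refine Finset.sum_congr rfl fun c hc => ?_
  rw [← ih _ (Finset.erase_ssubset hc), ← lsum_add]
  rfl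

/-- The truth value of a proposition as an integer. -/
noncomputable def ind (p : Prop) : ℤ := if p then 1 else 0

lemma ind_pos {p : Prop} (h : p) : ind p = 1 := if_pos h

lemma ind_neg {p : Prop} (h : ¬ p) : ind p = 0 := if_neg h

lemma ind_congr {p q : Prop} (h : p ↔ q) : ind p = ind q := by rw [propext h]

lemma ind_and (p q : Prop) : ind (p ∧ q) = ind p * ind q := by
  by_cases hp : p <;> by_cases hq : q <;> simp [ind, hp, hq]

/-- The total weight of a list. -/
def wsum (wt : α → ℝ) (l : List α) : ℝ := (l.map wt).sum

/-- A list is an excursion if its cumulative sums are nonnegative and its total weight is `0`. -/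
def IsExcursion (wt : α → ℝ) (l : List α) : Prop :=
  (∀ p, p <+: l → 0 ≤ wsum wt p) ∧ wsum wt l = 0

/-- No nonempty prefix of the list is an excursion. -/
def NoExcursionPrefix (wt : α → ℝ) (l : List α) : Prop :=
  ∀ p, p <+: l → p ≠ [] → ¬ IsExcursion wt p

/-- No nonempty contiguous sublist is an excursion. -/
def IsReduced (wt : α → ℝ) : List α → Prop
  | [] => True
  | a :: l => NoExcursionPrefix wt (a :: l) ∧ IsReduced wt l

/-- The truth value of `q` is unaffected by removing an excursion from a list. -/
def ExcursionInvariant (wt : α → ℝ) (q : List α → Prop) : Prop :=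
  ∀ a w b, IsExcursion wt w → (q (a ++ w ++ b) ↔ q (a ++ b))

lemma wsum_nil (wt : α → ℝ) : wsum wt [] = 0 := rfl

lemma wsum_append (wt : α → ℝ) (a b : List α) : wsum wt (a ++ b) = wsum wt a + wsum wt b := by
  simp [wsum]

lemma wsum_cons (wt : α → ℝ) (a : α) (b : List α) : wsum wt (a :: b) = wt a + wsum wt b := by
  simp [wsum]

lemma prefix_append_iff {p a b : List α} :
    p <+: a ++ b ↔ p <+: a ∨ ∃ t, t <+: b ∧ p = a ++ t := by
  constructor
  · rintro ⟨s, h⟩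
    rcases List.append_eq_append_iff.1 h with ⟨t, rfl, h2⟩ | ⟨t, rfl, h2⟩
    · exact Or.inl ⟨t, rfl⟩
    · exact Or.inr ⟨t, ⟨s, h2.symm⟩, rfl⟩
  · rintro (h | ⟨t, h, rfl⟩)
    · exact h.trans (List.prefix_append _ _)
    · exact (List.prefix_append_right_inj _).2 h

lemma isExcursion_nil (wt : α → ℝ) : IsExcursion wt [] := by
  refine ⟨fun p hp => ?_, rfl⟩
  rw [List.prefix_nil.1 hp, wsum_nil]

lemma noExcursionPrefix_nil (wt : α → ℝ) : NoExcursionPrefix wt [] :=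
  fun _ hp hp' => absurd (List.prefix_nil.1 hp) hp'

lemma excursionInvariant_isExcursion (wt : α → ℝ) :
    ExcursionInvariant wt (IsExcursion wt) := by
  intro a w b hw
  have hsum : ∀ t, wsum wt (a ++ w ++ t) = wsum wt (a ++ t) := fun t => by
    simp only [wsum_append, hw.2, add_zero]
  constructor
  · rintro ⟨h1, h2⟩
    refine ⟨fun p hp => ?_, by rw [← h2, hsum]⟩
    rcases prefix_append_iff.1 hp with h | ⟨t, h, rfl⟩
    · exact h1 p (by rw [List.append_assoc]; exact h.trans (List.prefix_append _ _))
    · rw [← hsum]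
      exact h1 _ ((List.prefix_append_right_inj _).2 h)
  · rintro ⟨h1, h2⟩
    refine ⟨fun p hp => ?_, by rw [← h2, hsum]⟩
    rcases prefix_append_iff.1 hp with h | ⟨t, h, rfl⟩
    · rcases prefix_append_iff.1 h with h | ⟨t, ht, rfl⟩
      · exact h1 p (h.trans (List.prefix_append _ _))
      · rw [wsum_append]
        exact add_nonneg (h1 a (List.prefix_append _ _)) (hw.1 _ ht)
    · rw [hsum]
      exact h1 _ ((List.prefix_append_right_inj _).2 h)

lemma isExcursion_append_iff {wt : α → ℝ} {w b : List α} (hw : IsExcursion wt w) :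
    IsExcursion wt (w ++ b) ↔ IsExcursion wt b :=
  excursionInvariant_isExcursion wt [] w b hw

lemma ExcursionInvariant.cons {wt : α → ℝ} {q : List α → Prop} (hq : ExcursionInvariant wt q)
    (c : α) : ExcursionInvariant wt fun l => q (c :: l) :=
  fun a w b hw => hq (c :: a) w b hw

lemma ExcursionInvariant.and {wt : α → ℝ} {q q' : List α → Prop} (hq : ExcursionInvariant wt q)
    (hq' : ExcursionInvariant wt q') : ExcursionInvariant wt fun l => q l ∧ q' l :=
  fun a w b hw => and_congr (hq a w b hw) (hq' a w b hw)

lemma excursionInvariant_noExcursionPrefix_cons (wt : α → ℝ) (c : α) :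
    ExcursionInvariant wt fun l => NoExcursionPrefix wt (c :: l) := by
  intro a w b hw
  change NoExcursionPrefix wt (c :: a ++ w ++ b) ↔ NoExcursionPrefix wt (c :: a ++ b)
  have hne : c :: a ≠ [] := by simp
  generalize c :: a = A at hne
  have hA : ∀ t, A ++ t ≠ [] := fun t h => hne (List.append_eq_nil_iff.1 h).1
  constructor
  · intro h p hp hp0 hpe
    rcases prefix_append_iff.1 hp with h' | ⟨t, h', rfl⟩
    · exact h p (by rw [List.append_assoc]; exact h'.trans (List.prefix_append _ _)) hp0 hpe
    · refine h (A ++ w ++ t) ((List.prefix_append_right_inj _).2 h') ?_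
        ((excursionInvariant_isExcursion wt A w t hw).2 hpe)
      rw [List.append_assoc]
      exact hA _
  · intro h p hp hp0 hpe
    rcases prefix_append_iff.1 hp with h' | ⟨t, h', rfl⟩
    · rcases prefix_append_iff.1 h' with h' | ⟨t, ht, rfl⟩
      · exact h p (h'.trans (List.prefix_append _ _)) hp0 hpe
      · refine h A (List.prefix_append _ _) hne ⟨fun p hp => hpe.1 p (hp.trans
          (List.prefix_append _ _)), ?_⟩
        have h1 := hpe.2
        have h2 := hpe.1 A (List.prefix_append _ _)
        have h3 := hw.1 t ht
        rw [wsum_append] at h1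
        linarith
    · exact h (A ++ t) ((List.prefix_append_right_inj _).2 h') (hA _)
        ((excursionInvariant_isExcursion wt A w t hw).1 hpe)

lemma existsUnique_last {P : ℕ → Prop} {n : ℕ} (h : ∃ i ≤ n, P i) :
    ∃! i, i ≤ n ∧ P i ∧ ∀ j, i < j → j ≤ n → ¬ P j := by
  obtain ⟨i, hi, hP⟩ := h
  refine ⟨Nat.findGreatest P n, ⟨Nat.findGreatest_le n, Nat.findGreatest_spec hi hP,
    fun j hj hj' => Nat.findGreatest_is_greatest hj hj'⟩, ?_⟩
  rintro k ⟨hk, hPk, hk'⟩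
  refine le_antisymm (Nat.le_findGreatest hk hPk) ?_
  by_contra! hlt
  exact hk' _ hlt (Nat.findGreatest_le n) (Nat.findGreatest_spec hi hP)

lemma csum_eq_one {P : List α → List α → Prop} {l : List α}
    (h : ∃! i, i ≤ l.length ∧ P (l.take i) (l.drop i)) :
    csum (fun u v => ind (P u v)) l = 1 := by
  obtain ⟨i, ⟨hi, hP⟩, hu⟩ := h
  rw [csum_eq_sum, Finset.sum_eq_single i]
  · exact ind_pos hP
  · intro j hj hji
    exact ind_neg fun hPj => hji (hu j ⟨by simpa [Nat.lt_succ_iff] using hj, hPj⟩)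
  · intro hi'
    exact absurd (by simpa [Nat.lt_succ_iff] using hi) hi'

/-- Every list has a longest prefix which is an excursion. -/
lemma csum_longest_excursion (wt : α → ℝ) (l : List α) :
    csum (fun u v => ind (IsExcursion wt u ∧ NoExcursionPrefix wt v)) l = 1 := by
  apply csum_eq_one (P := fun u v => IsExcursion wt u ∧ NoExcursionPrefix wt v)
  have := existsUnique_last (P := fun i => IsExcursion wt (l.take i)) (n := l.length)
    ⟨0, Nat.zero_le _, by simpa using isExcursion_nil wt⟩
  refine (existsUnique_congr fun i => ?_).1 this
  refine and_congr_right fun hi => and_congr_right fun he => ?_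
  constructor
  · intro h p hp hp0 hpe
    have h1 : l.take (i + p.length) = l.take i ++ p := by
      rw [List.take_add, List.prefix_iff_eq_take.1 hp]
      simp
    have h2 := hp.length_le
    have h3 := List.length_pos_iff.2 hp0
    rw [List.length_drop] at h2
    refine h (i + p.length) (by omega) (by omega) ?_
    simp only [h1]
    exact (isExcursion_append_iff he).2 hpe
  · intro h j hij hj hje
    have h1 : l.take j = l.take i ++ (l.drop i).take (j - i) := by
      rw [← List.take_add]
      congr 1
      omega
    rw [h1, isExcursion_append_iff he] at hje
    refine h _ (List.take_prefix _ _) ?_ hje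
    rw [← List.length_pos_iff, List.length_take, List.length_drop]
    omega

/-- Apply `g` to the head and the tail of a nonempty list. -/
def uncons (g : α → List α → ℤ) : List α → ℤ
  | [] => 0
  | c :: l => g c l

/-- The sum of `f` of the list `c₁ … cₘ` over all ways to write a list as `w₀ c₁ w₁ … cₘ wₘ`
with excursions `wᵢ`. -/
noncomputable def coreSum (wt : α → ℝ) : ℕ → (List α → ℤ) → List α → ℤ
  | 0, f => fun l => ind (IsExcursion wt l) * f []
  | m + 1, f => csum fun w r => ind (IsExcursion wt w) *
      uncons (fun c => coreSum wt m fun l => f (c :: l)) r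

/-- Every list arises from exactly one reduced list by inserting excursions. -/
lemma sum_coreSum (wt : α → ℝ) (n : ℕ) (q : List α → Prop) (hq : ExcursionInvariant wt q)
    (l : List α) (hl : l.length < n) :
    ∑ m ∈ Finset.range n, coreSum wt m (fun c => ind (IsReduced wt c ∧ q c)) l =
      ind (q l) := by
  induction n generalizing q l with
  | zero => simp at hl
  | succ n ih =>
    have h0 : coreSum wt 0 (fun c => ind (IsReduced wt c ∧ q c)) l =
        ∑ i ∈ Finset.range (l.length + 1), ind (IsExcursion wt (l.take i)) *
          (if l.drop i = [] then ind (q []) else 0) := by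
      rw [Finset.sum_eq_single l.length]
      · simp [coreSum, IsReduced]
      · intro i hi hne
        have : l.drop i ≠ [] := by
          rw [Ne, List.drop_eq_nil_iff]
          have := Finset.mem_range.1 hi
          omega
        simp [this]
      · simp
    rw [Finset.sum_range_succ', h0]
    simp only [coreSum, csum_eq_sum]
    rw [Finset.sum_comm, ← Finset.sum_add_distrib]
    trans ∑ i ∈ Finset.range (l.length + 1), ind (q l) *
      ind (IsExcursion wt (l.take i) ∧ NoExcursionPrefix wt (l.drop i))
    · refine Finset.sum_congr rfl fun i hi => ?_
      by_cases he : IsExcursion wt (l.take i)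
      swap
      · simp [ind, he]
      have hql : q l ↔ q (l.drop i) := by
        have := hq [] (l.take i) (l.drop i) he
        simpa using this
      simp only [he, true_and, ind_pos trivial, one_mul]
      have hlen : (l.drop i).length ≤ l.length := by simp
      rw [ind_congr hql]
      generalize l.drop i = r at *
      rcases r with _ | ⟨c, r⟩
      · simp [uncons, noExcursionPrefix_nil, ind]
      · have := ih (fun l => NoExcursionPrefix wt (c :: l) ∧ q (c :: l))
          ((excursionInvariant_noExcursionPrefix_cons wt c).and (hq.cons c)) r
          (by simp at hlen; omega)
        simp only [uncons, IsReduced]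
        rw [if_neg (by simp), add_zero]
        have h2 : ∀ c', (IsReduced wt c' ∧ NoExcursionPrefix wt (c :: c') ∧ q (c :: c')) ↔
            ((NoExcursionPrefix wt (c :: c') ∧ IsReduced wt c') ∧ q (c :: c')) := by
          intro c'
          tauto
        simp only [ind_congr (h2 _)] at this
        rw [this]
        by_cases h3 : NoExcursionPrefix wt (c :: r) <;> by_cases h4 : q (c :: r) <;>
          simp [ind, h3, h4]
    · rw [← Finset.mul_sum]
      have := csum_longest_excursion wt l
      rw [csum_eq_sum] at this
      rw [this, mul_one]

lemma lsum_uncons (g : α → List α → ℤ) (S : Finset α) :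
    lsum (uncons g) S = ∑ c ∈ S, lsum (g c) (S.erase c) := by
  rw [lsum_cons]
  simp [uncons]

/-- The number of orderings of `S` which are excursions. -/
noncomputable def excursionCount (wt : α → ℝ) (S : Finset α) : ℤ :=
  lsum (fun l => ind (IsExcursion wt l)) S

/-- The number of ways to split `S` into a `k`-tuple of excursions. -/
noncomputable def excursionPow (wt : α → ℝ) : ℕ → Finset α → ℤ
  | 0, S => if S = ∅ then 1 else 0
  | k + 1, S => ∑ B ∈ S.powerset, excursionCount wt B * excursionPow wt k (S \ B)

lemma sum_powerset_sdiff_comm {M : Type*} [AddCommMonoid M] (S : Finset α)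
    (g : Finset α → Finset α → M) :
    ∑ A ∈ S.powerset, ∑ B ∈ (S \ A).powerset, g A B =
      ∑ B ∈ S.powerset, ∑ A ∈ (S \ B).powerset, g A B := by
  refine Finset.sum_comm' fun A B => ?_
  simp only [Finset.mem_powerset, Finset.subset_sdiff]
  constructor
  · rintro ⟨h1, h2, h3⟩
    exact ⟨⟨h1, h3.symm⟩, h2⟩
  · rintro ⟨⟨h1, h3⟩, h2⟩
    exact ⟨h1, h2, h3.symm⟩

lemma sum_powerset_sdiff_eq {M : Type*} [AddCommMonoid M] (S : Finset α) (g : Finset α → M) :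
    ∑ B ∈ S.powerset, g (S \ B) = ∑ B ∈ S.powerset, g B := by
  refine Finset.sum_bij' (fun B _ => S \ B) (fun B _ => S \ B) ?_ ?_ ?_ ?_ ?_
  · intro B _
    simp
  · intro B _
    simp
  · intro B hB
    simpa using hB
  · intro B hB
    simpa using hB
  · intros
    rfl

lemma lsum_eq_sum_erase (f : List α → ℤ) {S : Finset α} (hS : S ≠ ∅) :
    lsum f S = ∑ c ∈ S, lsum (fun l => f (c :: l)) (S.erase c) := by
  rw [lsum_cons, if_neg hS, zero_add]

lemma lsum_coreSum (wt : α → ℝ) (m : ℕ) (f : List α → ℤ) (S : Finset α) :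
    lsum (coreSum wt m f) S = ∑ B ∈ S.powerset,
      if B.card = m then lsum f B * excursionPow wt (m + 1) (S \ B) else 0 := by
  induction m generalizing f S with
  | zero =>
    rw [coreSum, lsum_mul_const, Finset.sum_eq_single ∅]
    · rw [if_pos Finset.card_empty]
      have h1 : lsum f ∅ = f [] := by simp [lsum, orderings_empty]
      have h2 : excursionPow wt 1 S = excursionCount wt S := by
        rw [excursionPow, Finset.sum_eq_single S]
        · simp [excursionPow]
        · intro B hB hne
          rw [excursionPow, if_neg, mul_zero]
          rw [Finset.sdiff_eq_empty_iff_subset]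
          exact fun h => hne ((Finset.mem_powerset.1 hB).antisymm h)
        · simp
      rw [h1, zero_add, Finset.sdiff_empty, h2, mul_comm, excursionCount]
    · intro B _ hB
      rw [if_neg]
      simpa using hB
    · simp
  | succ m ih =>
    rw [coreSum, lsum_csum]
    trans ∑ W ∈ S.powerset, ∑ B ∈ (S \ W).powerset, excursionCount wt W *
        (if B.card = m + 1 then lsum f B * excursionPow wt (m + 1) ((S \ W) \ B) else 0)
    · refine Finset.sum_congr rfl fun W _ => ?_
      simp only [lsum_const_mul, lsum_uncons, lsum_mul_const, ih]
      rw [← Finset.mul_sum, excursionCount]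
      congr 1
      rw [← sum_powerset_sum_mem (S \ W) fun c B => if B.card = m then
        lsum (fun l => f (c :: l)) B * excursionPow wt (m + 1) ((S \ W).erase c \ B) else 0]
      refine Finset.sum_congr rfl fun B _ => ?_
      split_ifs with hB
      · rw [lsum_eq_sum_erase f (S := B) (by rintro rfl; simp at hB), Finset.sum_mul]
        refine Finset.sum_congr rfl fun c hc => ?_
        rw [if_pos (by rw [Finset.card_erase_of_mem hc, hB]; rfl)]
        congr 2
        ext a
        by_cases hac : a = c
        · simp [hac, hc]
        · simp [hac]
      · refine Finset.sum_eq_zero fun c hc => if_neg ?_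
        rw [Finset.card_erase_of_mem hc]
        have := Finset.card_pos.2 ⟨c, hc⟩
        omega
    · rw [sum_powerset_sdiff_comm]
      refine Finset.sum_congr rfl fun B _ => ?_
      split_ifs with hB
      · rw [excursionPow, Finset.mul_sum]
        refine Finset.sum_congr rfl fun W _ => ?_
        rw [sdiff_right_comm]
        ring
      · simp

/-- The tree condition on nonempty lists which are excursions. -/
def IsTreeList (wt : α → ℝ) : List α → Prop
  | [] => False
  | a :: l => IsExcursion wt (a :: l) ∧ IsReduced wt l

/-- The number of orderings of `S` satisfying the tree condition. -/
noncomputable def treeCount (wt : α → ℝ) (S : Finset α) : ℤ :=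
  lsum (fun l => ind (IsTreeList wt l)) S

lemma treeCount_empty (wt : α → ℝ) : treeCount wt ∅ = 0 := by
  simp [treeCount, lsum, orderings_empty, IsTreeList, ind]

/-- A nonempty excursion is obtained in a unique way from a list satisfying the tree condition by
inserting an excursion after each of its elements. -/
lemma excursionCount_eq (wt : α → ℝ) {S : Finset α} (hS : S ≠ ∅) :
    excursionCount wt S =
      ∑ B ∈ S.powerset, treeCount wt B * excursionPow wt B.card (S \ B) := by
  have h1 : ∀ x ∈ S, lsum (fun l => ind (IsExcursion wt (x :: l))) (S.erase x) =
      ∑ B ∈ (S.erase x).powerset, lsum (fun l => ind (IsTreeList wt (x :: l))) B *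
        excursionPow wt (B.card + 1) (S.erase x \ B) := by
    intro x hx
    have h2 : ∀ l ∈ orderings (S.erase x), ind (IsExcursion wt (x :: l)) =
        ∑ m ∈ Finset.range S.card, coreSum wt m (fun c => ind (IsTreeList wt (x :: c))) l := by
      intro l hl
      rw [← sum_coreSum wt S.card (fun l => IsExcursion wt (x :: l))
        ((excursionInvariant_isExcursion wt).cons x) l]
      · refine Finset.sum_congr rfl fun m _ => ?_
        congr 1
        funext c
        exact ind_congr and_comm
      · rw [length_of_mem_orderings hl]
        exact Finset.card_erase_lt_of_mem hx
    rw [lsum_congr h2, lsum_sum]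
    simp only [lsum_coreSum]
    rw [Finset.sum_comm]
    refine Finset.sum_congr rfl fun B hB => ?_
    rw [Finset.sum_ite_eq, if_pos]
    have h3 := Finset.card_le_card (Finset.mem_powerset.1 hB)
    have h4 := Finset.card_erase_lt_of_mem hx
    exact Finset.mem_range.2 (by omega)
  rw [excursionCount, lsum_eq_sum_erase _ hS, Finset.sum_congr rfl h1,
    ← sum_powerset_sum_mem S fun x B => lsum (fun l => ind (IsTreeList wt (x :: l))) B *
        excursionPow wt (B.card + 1) (S.erase x \ B)]
  refine Finset.sum_congr rfl fun B _ => ?_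
  by_cases hB : B = ∅
  · subst hB
    simp [treeCount_empty]
  · rw [treeCount, lsum_eq_sum_erase _ hB, Finset.sum_mul]
    refine Finset.sum_congr rfl fun x hx => ?_
    rw [Finset.card_erase_add_one hx]
    congr 2
    ext a
    by_cases hac : a = x
    · simp [hac, hx]
    · simp [hac]

lemma card_orderings (S : Finset α) : (orderings S).card = S.card.factorial := by
  have h : lsum (fun _ => 1) S = (S.card.factorial : ℤ) := by
    induction S using Finset.strongInduction with
    | H S ih =>
    by_cases hS : S = ∅
    · simp [lsum, hS, orderings_empty]
    · rw [lsum_eq_sum_erase _ hS,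
        Finset.sum_congr rfl fun c hc => ih _ (Finset.erase_ssubset hc),
        Finset.sum_congr rfl fun c hc => by rw [Finset.card_erase_of_mem hc],
        Finset.sum_const, nsmul_eq_mul]
      exact_mod_cast Nat.mul_factorial_pred (by simpa using hS)
  simpa [lsum] using h

/-- The list `a ++ s :: b` is an excursion which does not return to `0` before `s`. -/
def FirstReturn (wt : α → ℝ) (s : α) (a b : List α) : Prop :=
  (∀ p, p <+: a → p ≠ [] → 0 < wsum wt p) ∧ IsExcursion wt (a ++ s :: b)

lemma existsUnique_split_excursion {wt : α → ℝ} {l : List α} {s : α} (hl : l.Nodup) (hs : s ∈ l)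
    (he : IsExcursion wt l) :
    ∃! i, i ≤ l.length ∧ IsExcursion wt (l.take i) ∧
      ∃ a b, l.drop i = a ++ s :: b ∧ FirstReturn wt s a b := by
  obtain ⟨a₀, b₀, hab⟩ := List.append_of_mem hs
  have hs₀ : s ∉ a₀ ∧ s ∉ b₀ := by
    rw [hab, List.nodup_middle, List.nodup_cons, List.mem_append] at hl
    tauto
  have := existsUnique_last (P := fun i => IsExcursion wt (l.take i)) (n := a₀.length)
    ⟨0, Nat.zero_le _, by simpa using isExcursion_nil wt⟩
  refine (existsUnique_congr fun i => ?_).1 this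
  constructor
  · rintro ⟨hi, hei, h⟩
    refine ⟨by rw [hab]; simp; omega, hei, a₀.drop i, b₀, ?_, ?_, ?_⟩
    · rw [hab, List.drop_append_of_le_length hi]
    · intro p hp hp0
      have hpl : l.take (i + p.length) = l.take i ++ p := by
        have : p <+: l.drop i := by
          rw [hab, List.drop_append_of_le_length hi]
          exact hp.trans (List.prefix_append _ _)
        rw [List.take_add, List.prefix_iff_eq_take.1 this]
        simp
      have hlen := hp.length_le
      have hpos := List.length_pos_iff.2 hp0
      rw [List.length_drop] at hlen
      have h0 := he.1 _ (List.take_prefix (i + p.length) l)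
      rw [hpl, wsum_append, hei.2, zero_add] at h0
      refine lt_of_le_of_ne h0 fun h1 => h (i + p.length) (by omega) (by omega) ⟨fun q hq =>
        he.1 q (hq.trans (List.take_prefix _ _)), ?_⟩
      rw [hpl, wsum_append, hei.2, ← h1, zero_add]
    · rw [← List.drop_append_of_le_length hi, ← hab, ← isExcursion_append_iff hei,
        List.take_append_drop]
      exact he
  · rintro ⟨-, hei, a, b, hd, hpos, -⟩
    have h1 : (l.take i ++ a) ++ s :: b = a₀ ++ s :: b₀ := by
      rw [List.append_assoc, ← hd, List.take_append_drop, hab]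
    have h2 : l.take i ++ a = a₀ :=
      ((List.append_cons_inj_of_notMem hs₀.1 hs₀.2).1 h1.symm).1.symm
    have hi : i ≤ l.length := by
      by_contra! hlt
      rw [List.drop_eq_nil_of_le hlt.le] at hd
      simp at hd
    have h3 : i + a.length = a₀.length := by
      rw [← h2]
      simp [hi]
    refine ⟨by omega, hei, fun j hij hj hej => ?_⟩
    have h4 : l.take j = l.take i ++ a.take (j - i) := by
      have : l.take j = l.take i ++ (l.drop i).take (j - i) := by
        rw [← List.take_add]
        congr 1
        omega
      rw [this, hd, List.take_append_of_le_length (by omega)]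
    have h5 := hej.2
    rw [h4, wsum_append, hei.2, zero_add] at h5
    refine (hpos (a.take (j - i)) (List.take_prefix _ _) ?_).ne' h5
    rw [← List.length_pos_iff, List.length_take]
    omega

lemma existsUnique_rotation {wt : α → ℝ} {s : α} {c : List α} (hc : wt s + wsum wt c = 0) :
    ∃! i, i ≤ c.length ∧ FirstReturn wt s (c.drop i) (c.take i) := by
  have := existsUnique_last (P := fun i => ∀ j ≤ c.length, wsum wt (c.take i) ≤ wsum wt (c.take j))
    (n := c.length) (by
      obtain ⟨i, hi, h⟩ := Finset.exists_min_image (Finset.range (c.length + 1))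
        (fun i => wsum wt (c.take i)) ⟨0, by simp⟩
      exact ⟨i, by simpa [Nat.lt_succ_iff] using hi, fun j hj => h j (by simp; omega)⟩)
  refine (existsUnique_congr fun i => and_congr_right fun hi => ?_).1 this
  have hdrop : ∀ p, p <+: c.drop i → i + p.length ≤ c.length ∧
      wsum wt p = wsum wt (c.take (i + p.length)) - wsum wt (c.take i) := by
    intro p hp
    have hlen := hp.length_le
    rw [List.length_drop] at hlen
    refine ⟨by omega, ?_⟩
    have hpl : c.take (i + p.length) = c.take i ++ p := by
      rw [List.take_add, List.prefix_iff_eq_take.1 hp]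
      simp
    rw [hpl, wsum_append]
    ring
  have hsplit : wsum wt (c.drop i) = wsum wt c - wsum wt (c.take i) := by
    conv_rhs => rw [← List.take_append_drop i c, wsum_append]
    simp
  constructor
  · rintro ⟨hmin, hlast⟩
    have hlt : ∀ j, i < j → j ≤ c.length → wsum wt (c.take i) < wsum wt (c.take j) := by
      intro j hij hj
      by_contra! hle
      exact hlast j hij hj fun k hk => hle.trans (hmin k hk)
    refine ⟨fun p hp hp0 => ?_, fun p hp => ?_, ?_⟩
    · have hpos := List.length_pos_iff.2 hp0
      rw [(hdrop p hp).2, sub_pos]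
      exact hlt _ (by omega) (hdrop p hp).1
    · rcases prefix_append_iff.1 hp with h | ⟨t, ht, rfl⟩
      · rw [(hdrop p h).2, sub_nonneg]
        exact hmin _ (hdrop p h).1
      · rcases List.prefix_cons_iff.1 ht with rfl | ⟨t, rfl, ht'⟩
        · rw [List.append_nil, (hdrop _ (List.prefix_refl _)).2, sub_nonneg]
          exact hmin _ (hdrop _ (List.prefix_refl _)).1
        · have h1 : t = c.take t.length :=
            List.prefix_iff_eq_take.1 (ht'.trans (List.take_prefix _ _))
          have h2 := hmin t.length (by
            have := (ht'.trans (List.take_prefix _ _)).length_le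
            omega)
          rw [← h1] at h2
          rw [wsum_append, wsum_cons, hsplit]
          linarith
    · rw [wsum_append, wsum_cons, hsplit]
      linarith
  · rintro ⟨hpos, hexc⟩
    have hlt : ∀ j, i < j → j ≤ c.length → wsum wt (c.take i) < wsum wt (c.take j) := by
      intro j hij hj
      have h1 : (c.drop i).take (j - i) <+: c.drop i := List.take_prefix _ _
      have h2 : ((c.drop i).take (j - i)).length = j - i := by
        rw [List.length_take, List.length_drop]
        omega
      have h3 := hpos _ h1 (by rw [← List.length_pos_iff]; omega)
      rw [(hdrop _ h1).2, h2, sub_pos] at h3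
      rwa [show i + (j - i) = j by omega] at h3
    refine ⟨fun j hj => ?_, fun j hij hj h => (hlt j hij hj).not_ge (h i hi)⟩
    rcases lt_or_ge i j with hij | hij
    · exact (hlt j hij hj).le
    · have h1 := hexc.1 (c.drop i ++ s :: c.take j) ((List.prefix_append_right_inj _).2
        ((List.cons_prefix_cons).2 ⟨rfl, List.take_prefix_take_left hij⟩))
      rw [wsum_append, wsum_cons, hsplit] at h1
      linarith

lemma wsum_of_mem_orderings {wt : α → ℝ} {S : Finset α} {l : List α} (h : l ∈ orderings S) :
    wsum wt l = ∑ s ∈ S, wt s := by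
  rw [mem_orderings] at h
  have : S = l.toFinset := by
    ext a
    simp [h.2]
  rw [this, List.sum_toFinset _ h.1]
  rfl

lemma append_cons_mem_orderings {S : Finset α} {s : α} {a b : List α} (hs : s ∈ S) :
    a ++ s :: b ∈ orderings S ↔ b ++ a ∈ orderings (S.erase s) := by
  rw [← and_iff_right hs (b := b ++ a ∈ _), ← cons_mem_orderings, mem_orderings, mem_orderings]
  have hp : (a ++ s :: b).Perm (s :: (b ++ a)) :=
    List.perm_middle.trans (List.perm_append_comm.cons s)
  rw [hp.nodup_iff]
  simp only [hp.mem_iff]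

lemma lsum_firstReturn (wt : α → ℝ) (s : α) (S : Finset α) :
    lsum (fun l => ind (∃ a b, l = a ++ s :: b ∧ FirstReturn wt s a b)) S =
      if s ∈ S ∧ ∑ a ∈ S, wt a = 0 then ((S.card - 1).factorial : ℤ) else 0 := by
  split_ifs with h
  · obtain ⟨hs, h0⟩ := h
    have hD : ∀ c ∈ orderings (S.erase s), wt s + wsum wt c = 0 := fun c hc => by
      rw [wsum_of_mem_orderings hc, Finset.add_sum_erase _ _ hs, h0]
    rw [← Finset.card_erase_of_mem hs, ← card_orderings, lsum]
    simp only [ind]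
    rw [← Finset.sum_filter, Finset.sum_const, nsmul_eq_mul, mul_one, Nat.cast_inj]
    have hex : ∀ l ∈ (orderings S).filter (fun l => ∃ a b, l = a ++ s :: b ∧ FirstReturn wt s a b),
        ∃ a b, l = a ++ s :: b ∧ FirstReturn wt s a b := fun l hl => (Finset.mem_filter.1 hl).2
    choose! A B hAB hF using hex
    have hmem : ∀ l ∈ (orderings S).filter
        (fun l => ∃ a b, l = a ++ s :: b ∧ FirstReturn wt s a b),
        B l ++ A l ∈ orderings (S.erase s) := by
      intro l hl
      rw [← append_cons_mem_orderings hs, ← hAB l hl]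
      exact (Finset.mem_filter.1 hl).1
    refine Finset.card_bij (fun l _ => B l ++ A l) hmem ?_ ?_
    · intro l hl l' hl' heq
      have hu := existsUnique_rotation (hD _ (hmem l hl))
      have h1 : (B l).length = (B l').length := by
        refine hu.unique ⟨by simp, by simpa using hF l hl⟩ ⟨by rw [heq]; simp, ?_⟩
        simpa [heq] using hF l' hl'
      obtain ⟨h2, h3⟩ := List.append_inj heq h1
      rw [hAB l hl, hAB l' hl', h2, h3]
    · intro c hc
      obtain ⟨i, ⟨hi, hfr⟩, -⟩ := existsUnique_rotation (hD c hc)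
      have hl : c.drop i ++ s :: c.take i ∈ (orderings S).filter
          (fun l => ∃ a b, l = a ++ s :: b ∧ FirstReturn wt s a b) := by
        rw [Finset.mem_filter, append_cons_mem_orderings hs, List.take_append_drop]
        exact ⟨hc, _, _, rfl, hfr⟩
      refine ⟨_, hl, ?_⟩
      have h1 := hAB _ hl
      have hnd := (mem_orderings.1 (Finset.mem_filter.1 hl).1).1
      rw [List.nodup_middle, List.nodup_cons, List.mem_append] at hnd
      have := (List.append_cons_inj_of_notMem (by tauto) (by tauto)).1 h1
      rw [← this.1, ← this.2.2, List.take_append_drop]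
  · rw [← lsum_zero S]
    refine lsum_congr fun l hl => ind_neg ?_
    rintro ⟨a, b, rfl, -, hF⟩
    refine h ⟨((mem_orderings.1 hl).2 s).1 (by simp), ?_⟩
    rw [← wsum_of_mem_orderings hl, hF.2]

/-- Splitting off the cycle containing `s`. -/
lemma excursionCount_rec (wt : α → ℝ) {S : Finset α} {s : α} (hs : s ∈ S) :
    excursionCount wt S = ∑ B ∈ S.powerset, if s ∈ B ∧ ∑ a ∈ B, wt a = 0 then
      ((B.card - 1).factorial : ℤ) * excursionCount wt (S \ B) else 0 := by
  have h1 : ∀ l ∈ orderings S, ind (IsExcursion wt l) = csum (fun u v =>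
      ind (IsExcursion wt u) * ind (∃ a b, v = a ++ s :: b ∧ FirstReturn wt s a b)) l := by
    intro l hl
    rw [mem_orderings] at hl
    simp only [← ind_and]
    by_cases he : IsExcursion wt l
    · rw [ind_pos he, csum_eq_one
        (P := fun u v => IsExcursion wt u ∧ ∃ a b, v = a ++ s :: b ∧ FirstReturn wt s a b)]
      exact existsUnique_split_excursion hl.1 ((hl.2 s).2 hs) he
    · rw [ind_neg he, csum_eq_sum]
      refine (Finset.sum_eq_zero fun i _ => ind_neg ?_).symm
      rintro ⟨h1, a, b, h2, -, h3⟩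
      rw [← h2, ← isExcursion_append_iff h1, List.take_append_drop] at h3
      exact he h3
  rw [excursionCount, lsum_congr h1, lsum_csum]
  simp only [lsum_const_mul, lsum_mul_const, lsum_firstReturn]
  rw [← sum_powerset_sdiff_eq]
  refine Finset.sum_congr rfl fun B hB => ?_
  rw [Finset.sdiff_sdiff_eq_self (Finset.mem_powerset.1 hB), excursionCount]
  split_ifs
  · ring
  · ring

lemma wsum_take_add_wsum_drop (wt : α → ℝ) (l : List α) (i : ℕ) :
    wsum wt (l.take i) + wsum wt (l.drop i) = wsum wt l := by
  rw [← wsum_append, List.take_append_drop]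

lemma isReduced_iff {wt : α → ℝ} {l : List α} :
    IsReduced wt l ↔ ∀ i, NoExcursionPrefix wt (l.drop i) := by
  induction l with
  | nil => simp [IsReduced, noExcursionPrefix_nil]
  | cons a l ih =>
    rw [IsReduced, ih]
    constructor
    · rintro ⟨h1, h2⟩ (_ | i)
      exacts [h1, h2 i]
    · exact fun h => ⟨h 0, fun i => h (i + 1)⟩

lemma isExcursion_drop_take_iff {wt : α → ℝ} {l : List α} {i j : ℕ} (hij : i ≤ j) :
    IsExcursion wt ((l.take j).drop i) ↔
      (∀ t, i ≤ t → t ≤ j → wsum wt (l.take i) ≤ wsum wt (l.take t)) ∧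
        wsum wt (l.take i) = wsum wt (l.take j) := by
  have key : ∀ t, i ≤ t → wsum wt (l.take t) = wsum wt (l.take i) +
      wsum wt ((l.take t).drop i) := by
    intro t hit
    rw [← wsum_take_add_wsum_drop wt (l.take t) i, List.take_take, min_eq_left hit]
  constructor
  · rintro ⟨h1, h2⟩
    refine ⟨fun t hit htj => ?_, by rw [key j hij, h2, add_zero]⟩
    rw [key t hit]
    refine le_add_of_nonneg_right (h1 _ ?_)
    exact (List.take_prefix_take_left htj).drop i
  · rintro ⟨h1, h2⟩
    refine ⟨fun p hp => ?_, by linarith [key j hij]⟩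
    have hp' := List.prefix_iff_eq_take.1 hp
    rw [List.drop_take, List.take_take,
      ← Nat.add_sub_cancel_left (n := i) (m := min p.length (j - i)),
      ← List.drop_take] at hp'
    have h3 := h1 (i + min p.length (j - i)) (Nat.le_add_right _ _) (by omega)
    rw [key _ (Nat.le_add_right i (min p.length (j - i))), ← hp'] at h3
    linarith

lemma isReduced_tail_iff {wt : α → ℝ} {a : α} {l : List α} :
    IsReduced wt l ↔ ∀ i j, 1 ≤ i → i < j → j ≤ l.length + 1 →
      ¬ IsExcursion wt (((a :: l).take j).drop i) := by
  rw [isReduced_iff]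
  constructor
  · rintro h (_ | i) (_ | j) hi hij hj
    any_goals omega
    rw [List.take_succ_cons, List.drop_succ_cons, List.drop_take]
    refine h i _ (List.take_prefix _ _) ?_
    rw [ne_eq, ← List.length_eq_zero_iff, List.length_take, List.length_drop]
    omega
  · intro h i p hp hne he
    have h1 := List.length_pos_iff.2 hne
    have h2 := hp.length_le
    rw [List.length_drop] at h2
    refine h (i + 1) (i + p.length + 1) (by omega) (by omega) (by omega) ?_
    rw [List.take_succ_cons, List.drop_succ_cons, List.drop_take, Nat.add_sub_cancel_left,
      ← List.prefix_iff_eq_take.1 hp]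
    exact he

/-- The tree condition in terms of the cumulative sums `wsum wt (l.take i)`. -/
lemma isTreeList_iff {wt : α → ℝ} (hwt : ∀ a, wt a ≠ 0) {l : List α} (hl : l ≠ [])
    (h0 : wsum wt l = 0) :
    IsTreeList wt l ↔ (∀ i, 1 ≤ i → i < l.length → 0 < wsum wt (l.take i)) ∧
      ∀ k j, 1 ≤ k → k < j → j ≤ l.length → wsum wt (l.take (k - 1)) = wsum wt (l.take j) →
        0 < wsum wt (l.take j) → ∃ t, k ≤ t ∧ t < j ∧ wsum wt (l.take t) < wsum wt (l.take j) := by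
  obtain ⟨a, r, rfl⟩ := List.exists_cons_of_ne_nil hl
  rw [IsTreeList, isReduced_tail_iff (a := a)]
  have hlen : (a :: r).length = r.length + 1 := rfl
  generalize a :: r = l at *
  rw [← hlen]
  clear hlen
  constructor
  · rintro ⟨h1, h2⟩
    have hnn : ∀ t, 0 ≤ wsum wt (l.take t) := fun t => h1.1 _ (List.take_prefix _ _)
    constructor
    · intro i hi hil
      refine lt_of_le_of_ne (hnn i) fun h => ?_
      refine h2 i l.length hi hil le_rfl ((isExcursion_drop_take_iff hil.le).2 ⟨?_, ?_⟩)
      · intro t _ _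
        rw [← h]
        exact hnn t
      · rw [← h, List.take_length, h0]
    · intro k j hk hkj hj hkj' hpos
      by_contra! hcon
      have hk1 : 1 ≤ k - 1 := by
        by_contra hk1
        rw [show k - 1 = 0 by omega, List.take_zero, wsum_nil] at hkj'
        exact hpos.ne hkj'
      refine h2 (k - 1) j hk1 (by omega) hj ((isExcursion_drop_take_iff (by omega)).2 ⟨?_, hkj'⟩)
      intro t hkt htj
      rw [hkj']
      rcases htj.eq_or_lt with rfl | htj
      · exact le_rfl
      rcases hkt.eq_or_lt with rfl | hkt
      · exact hkj'.ge
      exact hcon t (by omega) htj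
  · rintro ⟨h1, h2⟩
    have hnn : ∀ t, 0 ≤ wsum wt (l.take t) := by
      intro t
      rcases Nat.eq_zero_or_pos t with rfl | ht
      · rw [List.take_zero, wsum_nil]
      rcases lt_or_ge t l.length with htl | htl
      · exact (h1 t ht htl).le
      · rw [List.take_of_length_le htl, h0]
    refine ⟨⟨fun p hp => ?_, h0⟩, fun i j hi hij hj he => ?_⟩
    · rw [List.prefix_iff_eq_take.1 hp]
      exact hnn _
    · rw [isExcursion_drop_take_iff hij.le] at he
      have hpos := h1 i hi (by omega)
      rcases (show i + 1 ≤ j from hij).eq_or_lt with rfl | hij'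
      · have h3 := he.2
        rw [← List.take_append_getElem (show i < l.length by omega), wsum_append, wsum_cons,
          wsum_nil, add_zero] at h3
        exact hwt _ (by linarith)
      · obtain ⟨t, ht1, ht2, ht3⟩ := h2 (i + 1) j (by omega) hij' hj he.2 (he.2 ▸ hpos)
        have := he.1 t (by omega) ht2.le
        linarith [he.2]

lemma cumSumOn_eq_wsum (wt : α → ℝ) (B : Finset α) (P : Fin B.card ≃ {x // x ∈ B}) (i : ℕ) :
    cumSumOn wt B P i = wsum wt ((List.ofFn fun j => (P j : α)).take i) := by
  rw [cumSumOn, wsum, List.map_take, List.map_ofFn, List.sum_take_ofFn]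
  rfl

lemma ofFn_mem_orderings (B : Finset α) (P : Fin B.card ≃ {x // x ∈ B}) :
    (List.ofFn fun j => (P j : α)) ∈ orderings B := by
  rw [mem_orderings]
  refine ⟨List.nodup_ofFn.2 (Subtype.val_injective.comp P.injective), fun a => ?_⟩
  rw [List.mem_ofFn]
  constructor
  · rintro ⟨j, rfl⟩
    exact (P j).2
  · intro ha
    exact ⟨P.symm ⟨a, ha⟩, by simp⟩

lemma exists_ofFn_eq {B : Finset α} {l : List α} (h : l ∈ orderings B) :
    ∃ P : Fin B.card ≃ {x // x ∈ B}, (List.ofFn fun j => (P j : α)) = l := by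
  have hlen := length_of_mem_orderings h
  rw [mem_orderings] at h
  let f : Fin B.card → {x // x ∈ B} :=
    fun j => ⟨l[(j : ℕ)]'(hlen.symm ▸ j.2), (h.2 _).1 (List.getElem_mem _)⟩
  have hf : Function.Injective f := by
    intro i j hij
    exact Fin.ext ((List.Nodup.getElem_inj_iff h.1).1 (congrArg Subtype.val hij))
  refine ⟨Equiv.ofBijective f
    ((Fintype.bijective_iff_injective_and_card f).2 ⟨hf, by simp⟩), ?_⟩
  refine List.ext_getElem (by simp [hlen]) fun i h1 h2 => ?_
  simp [f]

lemma posPermOn_and_treePermOn_iff {wt : α → ℝ} (hwt : ∀ a, wt a ≠ 0) {B : Finset α}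
    (hB : B.Nonempty) (hsum : ∑ a ∈ B, wt a = 0) (P : Fin B.card ≃ {x // x ∈ B}) :
    PosPermOn wt B P ∧ TreePermOn wt B P ↔ IsTreeList wt (List.ofFn fun j => (P j : α)) := by
  have hmem := ofFn_mem_orderings B P
  have hlen := length_of_mem_orderings hmem
  have hcard := hB.card_pos
  rw [isTreeList_iff hwt (List.ne_nil_of_length_pos (hlen.symm ▸ hcard))
    (by rw [wsum_of_mem_orderings hmem, hsum]), hlen]
  simp only [← cumSumOn_eq_wsum]
  constructor
  · rintro ⟨h1, -, h2, -⟩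
    exact ⟨fun i hi hiB => h1 i hi (by omega), h2⟩
  · rintro ⟨h1, h2⟩
    have h1' : PosPermOn wt B P := fun i hi hiB => h1 i hi (by omega)
    refine ⟨h1', fun i hi hiB => (h1' i hi hiB).ne', h2, fun k l hk hkl hl _ hneg => ?_⟩
    rcases hl.eq_or_lt with rfl | hl
    · rw [cumSumOn_eq_wsum, List.take_of_length_le hlen.le, wsum_of_mem_orderings hmem,
        hsum] at hneg
      exact absurd hneg (lt_irrefl _)
    · exact absurd hneg (h1 l (by omega) hl).not_gt

lemma numPosTree_eq_treeCount {wt : α → ℝ} (hwt : ∀ a, wt a ≠ 0) {B : Finset α}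
    (hB : B.Nonempty) (hsum : ∑ a ∈ B, wt a = 0) : (numPosTree wt B : ℤ) = treeCount wt B := by
  have h1 : treeCount wt B = (((orderings B).filter (IsTreeList wt)).card : ℤ) := by
    simp [treeCount, lsum, ind]
  rw [h1, numPosTree, Nat.card_eq_fintype_card, Fintype.card_subtype]
  congr 1
  refine Finset.card_bij (fun P _ => List.ofFn fun j => (P j : α)) ?_ ?_ ?_
  · intro P hP
    rw [Finset.mem_filter] at hP ⊢
    exact ⟨ofFn_mem_orderings B P, (posPermOn_and_treePermOn_iff hwt hB hsum P).1 hP.2⟩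
  · intro P _ Q _ hPQ
    exact Equiv.ext fun j => Subtype.ext (congrFun (List.ofFn_injective hPQ) j)
  · intro l hl
    rw [Finset.mem_filter] at hl
    obtain ⟨P, rfl⟩ := exists_ofFn_eq hl.1
    refine ⟨P, ?_, rfl⟩
    rw [Finset.mem_filter]
    exact ⟨Finset.mem_univ _, (posPermOn_and_treePermOn_iff hwt hB hsum P).2 hl.2⟩

section FiniteDifferences

variable {ι : Type*} [DecidableEq ι]

lemma sum_powerset_neg_one_pow_mul_pow (m : ι → ℤ) (s : Finset ι) (z : ℤ) (d : ℕ)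
    (hd : d < s.card) :
    ∑ A ∈ s.powerset, (-1) ^ A.card * (z - ∑ i ∈ A, m i) ^ d = 0 := by
  induction s using Finset.induction_on generalizing d with
  | empty => simp at hd
  | insert a s ha ih =>
    rw [Finset.card_insert_of_notMem ha] at hd
    rw [Finset.sum_powerset_insert ha, ← Finset.sum_add_distrib]
    trans ∑ A ∈ s.powerset, ∑ j ∈ Finset.range d, (-((-m a) ^ (d - j) * d.choose j)) *
      ((-1) ^ A.card * (z - ∑ i ∈ A, m i) ^ j)
    · refine Finset.sum_congr rfl fun A hA => ?_
      have haA : a ∉ A := fun h => ha (Finset.mem_powerset.1 hA h)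
      rw [Finset.card_insert_of_notMem haA, Finset.sum_insert haA]
      have h1 : z - (m a + ∑ i ∈ A, m i) = (z - ∑ i ∈ A, m i) + -m a := by ring
      rw [h1, add_pow, Finset.sum_range_succ, mul_add]
      have h2 : ∀ j ∈ Finset.range d, (-((-m a) ^ (d - j) * (d.choose j : ℤ))) *
          ((-1) ^ A.card * (z - ∑ i ∈ A, m i) ^ j) = (-1) ^ (A.card + 1) *
          ((z - ∑ i ∈ A, m i) ^ j * (-m a) ^ (d - j) * (d.choose j : ℤ)) := by
        intro j _
        ring
      rw [Finset.sum_congr rfl h2, ← Finset.mul_sum]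
      simp only [Nat.sub_self, pow_zero, Nat.choose_self, Nat.cast_one]
      ring
    · rw [Finset.sum_comm]
      refine Finset.sum_eq_zero fun j hj => ?_
      rw [← Finset.mul_sum, ih j (by have := Finset.mem_range.1 hj; omega), mul_zero]

lemma sum_powerset_sum_powerset_sdiff {M : Type*} [AddCommMonoid M] (s : Finset ι)
    (g : Finset ι → Finset ι → M) :
    ∑ A ∈ s.powerset, ∑ D ∈ (s \ A).powerset, g A D =
      ∑ C ∈ s.powerset, ∑ A ∈ C.powerset, g A (C \ A) := by
  rw [Finset.sum_sigma', Finset.sum_sigma']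
  refine Finset.sum_bij' (fun p _ => ⟨p.1 ∪ p.2, p.1⟩) (fun p _ => ⟨p.2, p.1 \ p.2⟩)
    ?_ ?_ ?_ ?_ ?_
  · rintro ⟨A, D⟩ h
    simp only [Finset.mem_sigma, Finset.mem_powerset, Finset.subset_sdiff] at h ⊢
    exact ⟨Finset.union_subset h.1 h.2.1, Finset.subset_union_left⟩
  · rintro ⟨C, A⟩ h
    simp only [Finset.mem_sigma, Finset.mem_powerset] at h ⊢
    exact ⟨h.2.trans h.1, Finset.sdiff_subset_sdiff h.1 le_rfl⟩
  · rintro ⟨A, D⟩ h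
    simp only [Finset.mem_sigma, Finset.mem_powerset, Finset.subset_sdiff] at h
    simp [Finset.union_sdiff_cancel_left h.2.2.symm]
  · rintro ⟨C, A⟩ h
    simp only [Finset.mem_sigma, Finset.mem_powerset] at h
    simp [Finset.union_sdiff_of_subset h.2]
  · rintro ⟨A, D⟩ h
    simp only [Finset.mem_sigma, Finset.mem_powerset, Finset.subset_sdiff] at h
    simp [Finset.union_sdiff_cancel_left h.2.2.symm]

/-- A special case of Hurwitz's multivariable generalization of Abel's binomial identity. -/
lemma sum_powerset_abel (m : ι → ℤ) {s : Finset ι} (hs : s.Nonempty) :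
    ∑ A ∈ s.powerset, (if A = ∅ then 0 else
      (1 - ∑ i ∈ A, m i) ^ (A.card - 1) * (∑ i ∈ A, m i) ^ (s \ A).card) = 1 := by
  have h1 : ∀ A ∈ s.powerset, (if A = ∅ then 0 else
      (1 - ∑ i ∈ A, m i) ^ (A.card - 1) * (∑ i ∈ A, m i) ^ (s \ A).card) =
      ∑ D ∈ (s \ A).powerset, (if A = ∅ then 0 else
        (-1) ^ D.card * (1 - ∑ i ∈ A, m i) ^ (A.card + D.card - 1)) := by
    intro A _
    split_ifs with hA
    · simp
    · have h2 : ∑ i ∈ A, m i = -(1 - ∑ i ∈ A, m i) + 1 := by ring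
      conv_lhs =>
        rw [h2, ← h2]
        enter [2]
        rw [h2, ← Finset.sum_pow_mul_eq_add_pow]
      rw [Finset.mul_sum]
      refine Finset.sum_congr rfl fun D _ => ?_
      have h3 := Finset.card_pos.2 (Finset.nonempty_iff_ne_empty.2 hA)
      rw [one_pow, mul_one, neg_pow, show A.card + D.card - 1 = A.card - 1 + D.card by omega,
        pow_add]
      ring
  rw [Finset.sum_congr rfl h1, sum_powerset_sum_powerset_sdiff]
  have h2 : ∀ C ∈ s.powerset, ∑ A ∈ C.powerset, (if A = ∅ then 0 else
      (-1) ^ (C \ A).card * (1 - ∑ i ∈ A, m i) ^ (A.card + (C \ A).card - 1)) =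
      (if C = ∅ then 1 else 0) - (-1) ^ C.card := by
    intro C _
    by_cases hC : C = ∅
    · simp [hC]
    have h3 := Finset.card_pos.2 (Finset.nonempty_iff_ne_empty.2 hC)
    have h4 : ∀ A ∈ C.powerset, (if A = ∅ then 0 else
        (-1) ^ (C \ A).card * (1 - ∑ i ∈ A, m i) ^ (A.card + (C \ A).card - 1)) =
        (-1) ^ C.card * ((-1) ^ A.card * (1 - ∑ i ∈ A, m i) ^ (C.card - 1)) -
          (if A = ∅ then (-1) ^ C.card else 0) := by
      intro A hA
      have h5 : C.card = A.card + (C \ A).card := by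
        rw [add_comm, Finset.card_sdiff_add_card_eq_card (Finset.mem_powerset.1 hA)]
      split_ifs with hA0
      · simp [hA0]
      · rw [h5, pow_add, sub_zero]
        have h6 : ((-1 : ℤ) ^ A.card) * (-1) ^ A.card = 1 := by
          rw [← mul_pow]
          simp
        linear_combination (-(-1) ^ (C \ A).card *
          (1 - ∑ i ∈ A, m i) ^ (A.card + (C \ A).card - 1)) * h6
    rw [Finset.sum_congr rfl h4, Finset.sum_sub_distrib, ← Finset.mul_sum,
      sum_powerset_neg_one_pow_mul_pow m C 1 _ (by omega), if_neg hC]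
    simp
  rw [Finset.sum_congr rfl h2, Finset.sum_sub_distrib,
    Finset.sum_powerset_neg_one_pow_card_of_nonempty hs]
  simp

end FiniteDifferences

lemma isPart_iff {wt : α → ℝ} {S : Finset α} {𝔭 : Finset (Finset α)} :
    IsPart wt S 𝔭 ↔ (∀ B ∈ 𝔭, B.Nonempty) ∧ (∀ B ∈ 𝔭, ∀ C ∈ 𝔭, B ≠ C → Disjoint B C) ∧
      𝔭.biUnion id = S ∧ ∀ B ∈ 𝔭, ∑ s ∈ B, wt s = 0 := by
  constructor
  · rintro ⟨h1, h2, h3, h4⟩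
    refine ⟨h1, fun B hB C hC hBC => ?_, ?_, h4⟩
    · rw [Finset.disjoint_left]
      intro a haB haC
      exact hBC ((h3 a (h2 B hB haB)).unique ⟨hB, haB⟩ ⟨hC, haC⟩)
    · ext a
      simp only [Finset.mem_biUnion, id]
      constructor
      · rintro ⟨B, hB, ha⟩
        exact h2 B hB ha
      · intro ha
        obtain ⟨B, hB, -⟩ := h3 a ha
        exact ⟨B, hB⟩
  · rintro ⟨h1, h2, rfl, h4⟩
    refine ⟨h1, fun B hB => Finset.subset_biUnion_of_mem id hB, fun a ha => ?_, h4⟩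
    simp only [Finset.mem_biUnion, id] at ha
    obtain ⟨B, hB, haB⟩ := ha
    refine ⟨B, ⟨hB, haB⟩, ?_⟩
    rintro C ⟨hC, haC⟩
    by_contra hne
    exact Finset.disjoint_left.1 (h2 C hC B hB hne) haC haB

lemma _root_.IsPart.union {wt : α → ℝ} {S B : Finset α} (hB : B ⊆ S) {p q : Finset (Finset α)}
    (hp : IsPart wt B p) (hq : IsPart wt (S \ B) q) : IsPart wt S (p ∪ q) := by
  rw [isPart_iff] at *
  obtain ⟨hp1, hp2, hp3, hp4⟩ := hp
  obtain ⟨hq1, hq2, hq3, hq4⟩ := hq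
  have hpq : ∀ C ∈ p, ∀ D ∈ q, Disjoint C D := by
    intro C hC D hD
    have h1 : C ⊆ B := hp3 ▸ Finset.subset_biUnion_of_mem id hC
    have h2 : D ⊆ S \ B := hq3 ▸ Finset.subset_biUnion_of_mem id hD
    exact Finset.disjoint_of_subset_left h1 (Finset.disjoint_of_subset_right h2
      Finset.disjoint_sdiff)
  refine ⟨fun C hC => ?_, fun C hC D hD hne => ?_, ?_, fun C hC => ?_⟩
  · rcases Finset.mem_union.1 hC with h | h
    exacts [hp1 C h, hq1 C h]
  · rcases Finset.mem_union.1 hC with h | h <;> rcases Finset.mem_union.1 hD with h' | h'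
    exacts [hp2 C h D h' hne, hpq C h D h', (hpq D h' C h).symm, hq2 C h D h' hne]
  · rw [Finset.union_biUnion, hp3, hq3, Finset.union_sdiff_of_subset hB]
  · rcases Finset.mem_union.1 hC with h | h
    exacts [hp4 C h, hq4 C h]

lemma _root_.IsPart.disjoint {wt : α → ℝ} {S B : Finset α} {p q : Finset (Finset α)}
    (hp : IsPart wt B p) (hq : IsPart wt (S \ B) q) : Disjoint p q := by
  rw [Finset.disjoint_left]
  intro C hC hC'
  obtain ⟨a, ha⟩ := hp.1 C hC
  exact (Finset.mem_sdiff.1 (hq.2.1 C hC' ha)).2 (hp.2.1 C hC ha)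

lemma _root_.IsPart.of_subset {wt : α → ℝ} {S : Finset α} {𝔭 A : Finset (Finset α)}
    (h : IsPart wt S 𝔭) (hA : A ⊆ 𝔭) : IsPart wt (A.biUnion id) A := by
  rw [isPart_iff] at *
  exact ⟨fun B hB => h.1 B (hA hB), fun B hB C hC => h.2.1 B (hA hB) C (hA hC), rfl,
    fun B hB => h.2.2.2 B (hA hB)⟩

lemma _root_.IsPart.sdiff {wt : α → ℝ} {S : Finset α} {𝔭 A : Finset (Finset α)}
    (h : IsPart wt S 𝔭) (hA : A ⊆ 𝔭) : IsPart wt (S \ A.biUnion id) (𝔭 \ A) := by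
  have : S \ A.biUnion id = (𝔭 \ A).biUnion id := by
    rw [isPart_iff] at h
    obtain ⟨-, h2, rfl, -⟩ := h
    ext a
    simp only [Finset.mem_sdiff, Finset.mem_biUnion, id, not_exists, not_and]
    constructor
    · rintro ⟨⟨B, hB, ha⟩, h3⟩
      exact ⟨B, ⟨hB, fun hBA => h3 B hBA ha⟩, ha⟩
    · rintro ⟨B, ⟨hB, hBA⟩, ha⟩
      refine ⟨⟨B, hB, ha⟩, fun C hC haC => ?_⟩
      have hne : B ≠ C := fun h => hBA (h ▸ hC)
      exact Finset.disjoint_left.1 (h2 B hB C (hA hC) hne) ha haC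
  rw [this]
  exact h.of_subset Finset.sdiff_subset

lemma _root_.IsPart.biUnion_eq {wt : α → ℝ} {S : Finset α} {𝔭 : Finset (Finset α)}
    (h : IsPart wt S 𝔭) : 𝔭.biUnion id = S := (isPart_iff.1 h).2.2.1

lemma _root_.IsPart.sum_card {wt : α → ℝ} {S : Finset α} {𝔭 : Finset (Finset α)}
    (h : IsPart wt S 𝔭) : ∑ B ∈ 𝔭, B.card = S.card := by
  rw [← h.biUnion_eq]
  exact (Finset.card_biUnion (isPart_iff.1 h).2.1).symm

lemma _root_.IsPart.eq_empty_iff {wt : α → ℝ} {S : Finset α} {𝔭 : Finset (Finset α)}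
    (h : IsPart wt S 𝔭) : 𝔭 = ∅ ↔ S = ∅ := by
  constructor
  · rintro rfl
    rw [← h.biUnion_eq, Finset.biUnion_empty]
  · rintro rfl
    refine Finset.eq_empty_of_forall_notMem fun B hB => ?_
    exact (h.1 B hB).ne_empty (Finset.subset_empty.1 (h.2.1 B hB))

lemma isPart_empty (wt : α → ℝ) : IsPart wt ∅ ∅ := by
  rw [isPart_iff]
  simp

lemma Xval_union {p q : Finset (Finset α)} (h : Disjoint p q) :
    Xval (p ∪ q) = Xval p * Xval q := Finset.prod_union h

lemma Xval_mul_sdiff {𝔭 A : Finset (Finset α)} (h : A ⊆ 𝔭) :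
    Xval A * Xval (𝔭 \ A) = Xval 𝔭 := by
  rw [← Xval_union Finset.disjoint_sdiff, Finset.union_sdiff_of_subset h]

variable [Fintype α]

/-- The partitions of `S` into nonempty blocks of total weight `0`. -/
noncomputable def parts (wt : α → ℝ) (S : Finset α) : Finset (Finset (Finset α)) :=
  Finset.univ.filter (IsPart wt S)

lemma mem_parts {wt : α → ℝ} {S : Finset α} {𝔭 : Finset (Finset α)} :
    𝔭 ∈ parts wt S ↔ IsPart wt S 𝔭 := by
  simp [parts]

lemma sum_parts_sum_parts {M : Type*} [AddCommMonoid M] (wt : α → ℝ) (S : Finset α)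
    (g : Finset (Finset α) → Finset (Finset α) → M) :
    ∑ B ∈ S.powerset, ∑ p ∈ parts wt B, ∑ q ∈ parts wt (S \ B), g p q =
      ∑ 𝔭 ∈ parts wt S, ∑ A ∈ 𝔭.powerset, g A (𝔭 \ A) := by
  simp only [Finset.sum_sigma']
  refine Finset.sum_bij' (fun x _ => ⟨x.2.1 ∪ x.2.2, x.2.1⟩)
    (fun x _ => ⟨x.2.biUnion id, x.2, x.1 \ x.2⟩) ?_ ?_ ?_ ?_ ?_
  · rintro ⟨B, p, q⟩ h
    simp only [Finset.mem_sigma, Finset.mem_powerset, mem_parts] at h ⊢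
    exact ⟨h.2.1.union h.1 h.2.2, Finset.subset_union_left⟩
  · rintro ⟨𝔭, A⟩ h
    simp only [Finset.mem_sigma, Finset.mem_powerset, mem_parts] at h ⊢
    refine ⟨?_, h.1.of_subset h.2, h.1.sdiff h.2⟩
    rw [← h.1.biUnion_eq]
    exact Finset.biUnion_subset_biUnion_of_subset_left _ h.2
  · rintro ⟨B, p, q⟩ h
    simp only [Finset.mem_sigma, Finset.mem_powerset, mem_parts] at h
    simp [Finset.union_sdiff_cancel_left (h.2.1.disjoint h.2.2), ← h.2.1.biUnion_eq]
  · rintro ⟨𝔭, A⟩ h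
    simp only [Finset.mem_sigma, Finset.mem_powerset, mem_parts] at h
    simp [Finset.union_sdiff_of_subset h.2]
  · rintro ⟨B, p, q⟩ h
    simp only [Finset.mem_sigma, Finset.mem_powerset, mem_parts] at h
    simp [Finset.union_sdiff_cancel_left (h.2.1.disjoint h.2.2)]

/-- The sum of `k ^ |𝔭| X(𝔭)` over all partitions `𝔭` of `S` into blocks of total weight `0`. -/
noncomputable def partSum (wt : α → ℝ) (k : ℤ) (S : Finset α) : ℤ :=
  ∑ 𝔭 ∈ parts wt S, k ^ 𝔭.card * Xval 𝔭

lemma partSum_add (wt : α → ℝ) (j k : ℤ) (S : Finset α) :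
    partSum wt (j + k) S = ∑ B ∈ S.powerset, partSum wt j B * partSum wt k (S \ B) := by
  simp only [partSum, Finset.sum_mul_sum]
  rw [sum_parts_sum_parts wt S fun p q => j ^ p.card * Xval p * (k ^ q.card * Xval q)]
  refine Finset.sum_congr rfl fun 𝔭 _ => ?_
  rw [← Finset.sum_pow_mul_eq_add_pow, Finset.sum_mul]
  refine Finset.sum_congr rfl fun A hA => ?_
  rw [Finset.mem_powerset] at hA
  rw [← Xval_mul_sdiff hA, Finset.card_sdiff_of_subset hA]
  push_cast
  ring

lemma parts_empty (wt : α → ℝ) : parts wt ∅ = {∅} := by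
  ext 𝔭
  rw [mem_parts, Finset.mem_singleton]
  constructor
  · intro h
    exact h.eq_empty_iff.2 rfl
  · rintro rfl
    exact isPart_empty wt

lemma partSum_empty (wt : α → ℝ) (k : ℤ) : partSum wt k ∅ = 1 := by
  simp [partSum, parts_empty, Xval]

lemma partSum_zero (wt : α → ℝ) {S : Finset α} (hS : S ≠ ∅) : partSum wt 0 S = 0 := by
  refine Finset.sum_eq_zero fun 𝔭 h𝔭 => ?_
  have : 𝔭 ≠ ∅ := fun h => hS ((mem_parts.1 h𝔭).eq_empty_iff.1 h)
  rw [zero_pow (by simpa using this), zero_mul]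

lemma sum_parts_card_one (wt : α → ℝ) (B : Finset α) (s : α) :
    ∑ p ∈ parts wt B, (if p.card = 1 ∧ s ∈ p.biUnion id then (Xval p : ℤ) else 0) =
      if s ∈ B ∧ ∑ a ∈ B, wt a = 0 then ((B.card - 1).factorial : ℤ) else 0 := by
  have hB : ∀ p ∈ parts wt B, p.card = 1 → p = {B} := by
    intro p hp h1
    obtain ⟨C, rfl⟩ := Finset.card_eq_one.1 h1
    rw [← (mem_parts.1 hp).biUnion_eq]
    simp
  split_ifs with h
  · rw [Finset.sum_eq_single {B}]
    · simp [h.1, Xval]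
    · intro p hp hne
      exact if_neg fun h' => hne (hB p hp h'.1)
    · intro hp
      refine absurd ?_ hp
      rw [mem_parts, isPart_iff]
      simp [h.2, show B.Nonempty from ⟨s, h.1⟩]
  · refine Finset.sum_eq_zero fun p hp => if_neg ?_
    rintro ⟨h1, h2⟩
    have hp' := mem_parts.1 hp
    rw [hp'.biUnion_eq] at h2
    have h3 := hB p hp h1
    subst h3
    exact h ⟨h2, hp'.2.2.2 B (by simp)⟩

lemma partSum_one_rec (wt : α → ℝ) {S : Finset α} {s : α} (hs : s ∈ S) :
    partSum wt 1 S = ∑ B ∈ S.powerset, if s ∈ B ∧ ∑ a ∈ B, wt a = 0 then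
      ((B.card - 1).factorial : ℤ) * partSum wt 1 (S \ B) else 0 := by
  have h1 : ∀ B ∈ S.powerset, (if s ∈ B ∧ ∑ a ∈ B, wt a = 0 then
      ((B.card - 1).factorial : ℤ) * partSum wt 1 (S \ B) else 0) =
      ∑ p ∈ parts wt B, ∑ q ∈ parts wt (S \ B),
        (if p.card = 1 ∧ s ∈ p.biUnion id then (Xval p : ℤ) else 0) * Xval q := by
    intro B _
    rw [← Finset.sum_mul_sum, sum_parts_card_one, ite_mul, zero_mul]
    simp [partSum]
  rw [Finset.sum_congr rfl h1, sum_parts_sum_parts wt S fun p q =>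
    (if p.card = 1 ∧ s ∈ p.biUnion id then (Xval p : ℤ) else 0) * Xval q]
  refine Finset.sum_congr rfl fun 𝔭 h𝔭 => ?_
  rw [mem_parts] at h𝔭
  obtain ⟨B, ⟨hB, hsB⟩, hu⟩ := h𝔭.2.2.1 s hs
  rw [Finset.sum_eq_single {B}]
  · rw [if_pos (by simpa using hsB), one_pow, one_mul,
      ← Xval_mul_sdiff (Finset.singleton_subset_iff.2 hB)]
    push_cast
    rfl
  · intro A hA hne
    rw [if_neg, zero_mul]
    rintro ⟨h2, h3⟩
    obtain ⟨C, rfl⟩ := Finset.card_eq_one.1 h2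
    rw [Finset.mem_powerset, Finset.singleton_subset_iff] at hA
    rw [Finset.singleton_biUnion] at h3
    exact hne (by rw [hu C ⟨hA, h3⟩])
  · intro h
    simp [hB] at h

lemma excursionCount_eq_partSum (wt : α → ℝ) (S : Finset α) :
    excursionCount wt S = partSum wt 1 S := by
  induction S using Finset.strongInduction with
  | H S ih =>
  rcases S.eq_empty_or_nonempty with rfl | ⟨s, hs⟩
  · simp [partSum_empty, excursionCount, lsum, orderings_empty, ind_pos (isExcursion_nil wt)]
  · rw [excursionCount_rec wt hs, partSum_one_rec wt hs]
    refine Finset.sum_congr rfl fun B hB => ?_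
    split_ifs with h
    · rw [ih]
      exact Finset.sdiff_ssubset (Finset.mem_powerset.1 hB) ⟨s, h.1⟩
    · rfl

lemma excursionPow_eq_partSum (wt : α → ℝ) (k : ℕ) (S : Finset α) :
    excursionPow wt k S = partSum wt k S := by
  induction k generalizing S with
  | zero =>
    rw [excursionPow]
    split_ifs with hS
    · rw [hS, partSum_empty]
    · exact (partSum_zero wt hS).symm
  | succ k ih =>
    rw [excursionPow, Nat.cast_succ, add_comm (k : ℤ) 1, partSum_add]
    simp only [ih, excursionCount_eq_partSum]

/-- The signed sum over partitions which counts the orderings satisfying the tree condition. -/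
noncomputable def treeSum (wt : α → ℝ) (S : Finset α) : ℤ :=
  ∑ 𝔭 ∈ parts wt S, if 𝔭 = ∅ then 0 else (1 - (S.card : ℤ)) ^ (𝔭.card - 1) * Xval 𝔭

lemma sum_treeSum (wt : α → ℝ) {S : Finset α} (hS : S ≠ ∅) :
    ∑ B ∈ S.powerset, treeSum wt B * partSum wt B.card (S \ B) = partSum wt 1 S := by
  have h1 : ∀ B ∈ S.powerset, treeSum wt B * partSum wt B.card (S \ B) =
      ∑ p ∈ parts wt B, ∑ q ∈ parts wt (S \ B),
        (if p = ∅ then 0 else (1 - ∑ b ∈ p, (b.card : ℤ)) ^ (p.card - 1) * Xval p) *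
          ((∑ b ∈ p, (b.card : ℤ)) ^ q.card * Xval q) := by
    intro B _
    rw [treeSum, partSum, Finset.sum_mul_sum]
    refine Finset.sum_congr rfl fun p hp => ?_
    rw [← (mem_parts.1 hp).sum_card]
    push_cast
    rfl
  rw [Finset.sum_congr rfl h1, sum_parts_sum_parts wt S fun p q =>
    (if p = ∅ then 0 else (1 - ∑ b ∈ p, (b.card : ℤ)) ^ (p.card - 1) * Xval p) *
          ((∑ b ∈ p, (b.card : ℤ)) ^ q.card * Xval q)]
  refine Finset.sum_congr rfl fun 𝔭 h𝔭 => ?_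
  have h𝔭0 : 𝔭.Nonempty := by
    rw [Finset.nonempty_iff_ne_empty]
    exact fun h => hS ((mem_parts.1 h𝔭).eq_empty_iff.1 h)
  rw [one_pow]
  refine Eq.trans ?_ (congrArg (· * (Xval 𝔭 : ℤ))
    (sum_powerset_abel (fun b : Finset α => (b.card : ℤ)) h𝔭0))
  rw [Finset.sum_mul]
  refine Finset.sum_congr rfl fun A hA => ?_
  rw [← Xval_mul_sdiff (Finset.mem_powerset.1 hA)]
  split_ifs
  · simp
  · push_cast
    ring

lemma treeSum_empty (wt : α → ℝ) : treeSum wt ∅ = 0 := by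
  simp [treeSum, parts_empty]

lemma treeCount_eq_treeSum (wt : α → ℝ) (S : Finset α) : treeCount wt S = treeSum wt S := by
  induction S using Finset.strongInduction with
  | H S ih =>
  by_cases hS : S = ∅
  · rw [hS, treeCount_empty, treeSum_empty]
  have h1 := excursionCount_eq wt hS
  rw [excursionCount_eq_partSum, ← sum_treeSum wt hS] at h1
  simp only [excursionPow_eq_partSum] at h1
  rw [← Finset.add_sum_erase _ _ (Finset.mem_powerset_self S),
    ← Finset.add_sum_erase _ _ (Finset.mem_powerset_self S)] at h1
  have h2 : ∀ B ∈ S.powerset.erase S, treeCount wt B * partSum wt B.card (S \ B) =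
      treeSum wt B * partSum wt B.card (S \ B) := by
    intro B hB
    rw [Finset.mem_erase, Finset.mem_powerset] at hB
    rw [ih B (lt_of_le_of_ne hB.2 hB.1)]
  rw [Finset.sum_congr rfl h2, Finset.sdiff_self, partSum_empty] at h1
  linarith

end TreePassport

open Classical in
theorem stmt_17 {α : Type*} [Fintype α] (wt : α → ℝ)
    (hwt : ∀ s, wt s ≠ 0) (hsum : ∑ s, wt s = 0) (hcard : 2 ≤ Fintype.card α) :
    (numPosTree wt Finset.univ : ℤ) =
      ∑ 𝔭 ∈ Finset.univ.filter (IsPart wt Finset.univ),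
        (-1 : ℤ) ^ (𝔭.card - 1) * ((Fintype.card α - 1 : ℕ) : ℤ) ^ (𝔭.card - 1) *
          (Xval 𝔭 : ℤ) := by
  have hne : (Finset.univ : Finset α).Nonempty := by
    rw [← Finset.card_pos, Finset.card_univ]
    omega
  rw [TreePassport.numPosTree_eq_treeCount hwt hne hsum, TreePassport.treeCount_eq_treeSum,
    TreePassport.treeSum, TreePassport.parts]
  refine Finset.sum_congr (by congr) fun 𝔭 h𝔭 => ?_
  rw [Finset.mem_filter] at h𝔭
  rw [if_neg fun h => hne.ne_empty (h𝔭.2.eq_empty_iff.1 h), ← mul_pow, Finset.card_univ,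
    Nat.cast_sub (by omega)]
  congr 2
  push_cast
  ring
end

section
/- For any full passport (S, wt), the number of non-negative permutations satisfies |P_{≥0}| = Σ over ordered tuples (S_1,…,S_n) of ∏_{i=1}^{n} |P_+(S_i, wt)|, where the sum ranges over all n ≥ 1 and all ordered tuples of pairwise disjoint nonempty subsets of S with union S such that Σ_{s∈S_i} wt(s) = 0 for each i. -/
open Finset

/-- `|P_{≥0}(B, wt)|`: the number of permutations of `B` with all proper
cumulative sums nonnegative. -/
noncomputable def numNonneg {α : Type*} (wt : α → ℝ) (B : Finset α) : ℕ :=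
  Nat.card {P : Fin B.card ≃ {x // x ∈ B} //
    ∀ i, 1 ≤ i → i ≤ B.card - 1 → 0 ≤ cumSumOn wt B P i}

/-- An ordered tuple `(S_1, …, S_n)` of pairwise disjoint nonempty zero-sum
subsets covering the whole index set. -/
def OrderedTuple {α : Type*} (wt : α → ℝ) (n : ℕ) (f : Fin n → Finset α) : Prop :=
  (∀ i, (f i).Nonempty) ∧ (∀ i, ∑ s ∈ f i, wt s = 0) ∧
  (∀ i j, i ≠ j → Disjoint (f i) (f j)) ∧ (∀ a : α, ∃ i, a ∈ f i)

open Classical in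
/-- The linear orderings of the finite set `B`, as duplicate-free lists. -/
noncomputable def orderings {α : Type*} (B : Finset α) : Finset (List α) :=
  ⟨Multiset.lists B.val, Multiset.lists_nodup_finset B⟩

open Classical in
lemma mem_orderings {α : Type*} {B : Finset α} {l : List α} :
    l ∈ orderings B ↔ l.Nodup ∧ l.toFinset = B := by
  have h : l ∈ orderings B ↔ B.val = (l : Multiset α) := Multiset.mem_lists_iff B.val l
  rw [h]
  constructor
  · intro h
    have hn : l.Nodup := by
      have := B.nodup
      rwa [h, Multiset.coe_nodup] at this
    refine ⟨hn, ?_⟩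
    ext a
    rw [List.mem_toFinset, ← Finset.mem_val, h, Multiset.mem_coe]
  · rintro ⟨hn, rfl⟩
    rw [List.toFinset_val, hn.dedup]

/-- The `i`-th cumulative sum of the list `l`. -/
def partialSum {α : Type*} (wt : α → ℝ) (l : List α) (i : ℕ) : ℝ :=
  ((l.take i).map wt).sum

/-- All proper cumulative sums of the list are positive. -/
def PosList {α : Type*} (wt : α → ℝ) (l : List α) : Prop :=
  ∀ i, 1 ≤ i → i ≤ l.length - 1 → 0 < partialSum wt l i

/-- All proper cumulative sums of the list are nonnegative. -/
def NonnegList {α : Type*} (wt : α → ℝ) (l : List α) : Prop :=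
  ∀ i, 1 ≤ i → i ≤ l.length - 1 → 0 ≤ partialSum wt l i

lemma cumSumOn_eq_partialSum {α : Type*} (wt : α → ℝ) (B : Finset α)
    (P : Fin B.card ≃ {x // x ∈ B}) (i : ℕ) :
    cumSumOn wt B P i = partialSum wt (List.ofFn fun j => (P j : α)) i := by
  rw [cumSumOn, partialSum, List.map_take, List.map_ofFn, List.sum_take_ofFn]
  rfl

open Classical in
lemma card_equiv_eq_card_orderings {α : Type*} (B : Finset α) (Q : List α → Prop) :
    Nat.card {P : Fin B.card ≃ {x // x ∈ B} // Q (List.ofFn fun j => (P j : α))} =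
      ((orderings B).filter Q).card := by
  rw [← Nat.card_eq_finsetCard ((orderings B).filter Q)]
  refine Nat.card_congr (Equiv.ofBijective (fun P => ⟨List.ofFn fun j => (P.1 j : α), ?_⟩) ⟨?_, ?_⟩)
  · rw [Finset.mem_filter, mem_orderings]
    refine ⟨⟨List.nodup_ofFn.2 (Subtype.val_injective.comp P.1.injective), ?_⟩, P.2⟩
    ext a
    rw [List.mem_toFinset, List.mem_ofFn']
    constructor
    · rintro ⟨j, rfl⟩
      exact (P.1 j).2
    · intro ha
      exact ⟨P.1.symm ⟨a, ha⟩, by simp⟩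
  · intro P P' h
    have h' := List.ofFn_injective (Subtype.ext_iff.1 h)
    exact Subtype.ext (Equiv.ext fun j => Subtype.ext (congrFun h' j))
  · rintro ⟨l, hl⟩
    rw [Finset.mem_filter, mem_orderings] at hl
    obtain ⟨⟨hn, rfl⟩, hQ⟩ := hl
    have hc : l.toFinset.card = l.length := List.toFinset_card_of_nodup hn
    let g : Fin l.toFinset.card → {x // x ∈ l.toFinset} := fun j =>
      ⟨l.get (Fin.cast hc j), List.mem_toFinset.2 (List.get_mem _ _)⟩
    have hg : Function.Bijective g := by
      rw [Fintype.bijective_iff_injective_and_card]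
      refine ⟨fun i j h => ?_, by rw [Fintype.card_fin, Fintype.card_coe]⟩
      exact Fin.cast_injective hc (hn.injective_get (Subtype.ext_iff.1 h))
    have hl : (List.ofFn fun j => (Equiv.ofBijective g hg j : α)) = l := by
      refine List.ext_getElem (by simp [hc]) fun i h₁ h₂ => ?_
      simp [g]
    exact ⟨⟨Equiv.ofBijective g hg, hl.symm ▸ hQ⟩, Subtype.ext hl⟩

lemma partialSum_append_of_le {α : Type*} (wt : α → ℝ) {l₁ l₂ : List α} {i : ℕ}
    (hi : i ≤ l₁.length) : partialSum wt (l₁ ++ l₂) i = partialSum wt l₁ i := by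
  simp [partialSum, List.take_append_of_le_length hi]

lemma partialSum_append_add {α : Type*} (wt : α → ℝ) (l₁ l₂ : List α) (i : ℕ) :
    partialSum wt (l₁ ++ l₂) (l₁.length + i) = (l₁.map wt).sum + partialSum wt l₂ i := by
  simp [partialSum, List.take_length_add_append]

lemma partialSum_length {α : Type*} (wt : α → ℝ) (l : List α) :
    partialSum wt l l.length = (l.map wt).sum := by
  simp [partialSum]

lemma sum_map_of_mem_orderings {α : Type*} (wt : α → ℝ) {B : Finset α} {l : List α}
    (h : l ∈ orderings B) : (l.map wt).sum = ∑ s ∈ B, wt s := by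
  classical
  obtain ⟨hn, hB⟩ := mem_orderings.1 h
  rw [← List.sum_toFinset wt hn]
  congr 1

lemma NonnegList.append {α : Type*} {wt : α → ℝ} {l₁ l₂ : List α} (h₁ : PosList wt l₁)
    (hs : (l₁.map wt).sum = 0) (h₂ : NonnegList wt l₂) : NonnegList wt (l₁ ++ l₂) := by
  intro i hi hi'
  rw [List.length_append] at hi'
  rcases lt_or_ge i l₁.length with h | h
  · rw [partialSum_append_of_le wt h.le]
    exact (h₁ i hi (by omega)).le
  · obtain ⟨j, rfl⟩ := Nat.exists_eq_add_of_le h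
    rw [partialSum_append_add, hs, zero_add]
    rcases Nat.eq_zero_or_pos j with rfl | hj
    · simp [partialSum]
    · exact h₂ j hj (by omega)

/-- A positive prefix of a list is no longer than any nonempty zero-sum prefix of it. -/
lemma PosList.length_le_of_append_eq {α : Type*} {wt : α → ℝ} {l₁ l₂ m₁ m₂ : List α}
    (hl : PosList wt l₁) (hm : m₁ ≠ []) (hs : (m₁.map wt).sum = 0)
    (h : l₁ ++ l₂ = m₁ ++ m₂) : l₁.length ≤ m₁.length := by
  by_contra! hlt
  have h0 := List.length_pos_iff.2 hm
  have := hl m₁.length h0 (by omega)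
  rw [← partialSum_append_of_le wt (l₂ := l₂) hlt.le, h, partialSum_append_of_le wt le_rfl,
    partialSum_length, hs] at this
  exact this.false

/-- Cutting a nonnegative zero-sum list at its first return to zero. -/
lemma NonnegList.exists_append {α : Type*} {wt : α → ℝ} {l : List α} (h : NonnegList wt l)
    (hl : l ≠ []) (hs : (l.map wt).sum = 0) :
    ∃ l₁ l₂, l₁ ++ l₂ = l ∧ l₁ ≠ [] ∧ (l₁.map wt).sum = 0 ∧ PosList wt l₁ ∧
      NonnegList wt l₂ := by
  classical
  have h0 := List.length_pos_iff.2 hl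
  have hex : ∃ k, 1 ≤ k ∧ partialSum wt l k = 0 :=
    ⟨l.length, h0, by rw [partialSum_length, hs]⟩
  obtain ⟨hk1, hk0⟩ := Nat.find_spec hex
  have hkl : Nat.find hex ≤ l.length :=
    Nat.find_min' hex ⟨h0, by rw [partialSum_length, hs]⟩
  have hmin : ∀ i, 1 ≤ i → i < Nat.find hex → partialSum wt l i ≠ 0 :=
    fun i hi hlt h => Nat.find_min hex hlt ⟨hi, h⟩
  generalize Nat.find hex = k at hk1 hk0 hkl hmin
  have hlen : (l.take k).length = k := by simp [hkl]
  have happ : l.take k ++ l.drop k = l := List.take_append_drop k l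
  refine ⟨l.take k, l.drop k, happ, ?_, hk0, ?_, ?_⟩
  · rw [← List.length_pos_iff, hlen]
    exact hk1
  · intro i hi hi'
    rw [hlen] at hi'
    rw [← partialSum_append_of_le wt (l₂ := l.drop k) (by omega), happ]
    exact lt_of_le_of_ne (h i hi (by omega)) (hmin i hi (by omega)).symm
  · intro i hi hi'
    rw [List.length_drop] at hi'
    have := h (k + i) (by omega) (by omega)
    have e := partialSum_append_add wt (l.take k) (l.drop k) i
    rw [happ, hlen] at e
    rw [e, ← partialSum, hk0, zero_add] at this
    exact this

lemma numPos_eq {α : Type*} (wt : α → ℝ) (B : Finset α) [DecidablePred (PosList wt)] :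
    numPos wt B = ((orderings B).filter (PosList wt)).card := by
  classical
  rw [numPos]
  convert card_equiv_eq_card_orderings B (PosList wt) using 4
  simp [PosPermOn, PosList, cumSumOn_eq_partialSum]

lemma numNonneg_eq {α : Type*} (wt : α → ℝ) (B : Finset α) [DecidablePred (NonnegList wt)] :
    numNonneg wt B = ((orderings B).filter (NonnegList wt)).card := by
  classical
  rw [numNonneg]
  convert card_equiv_eq_card_orderings B (NonnegList wt) using 4
  simp [NonnegList, cumSumOn_eq_partialSum]

lemma numNonneg_empty {α : Type*} (wt : α → ℝ) : numNonneg wt (∅ : Finset α) = 1 := by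
  classical
  rw [numNonneg_eq, Finset.card_eq_one]
  refine ⟨[], ?_⟩
  ext l
  simp only [Finset.mem_filter, mem_orderings, List.toFinset_eq_empty_iff, Finset.mem_singleton]
  constructor
  · exact fun h => h.1.2
  · rintro rfl
    exact ⟨⟨List.nodup_nil, rfl⟩, fun i hi hi' => absurd hi (by simp at hi'; omega)⟩

open Classical in
/-- The nonempty zero-sum subsets of `B`. -/
noncomputable def zeroSumBlocks {α : Type*} (wt : α → ℝ) (B : Finset α) : Finset (Finset α) :=
  B.powerset.filter fun A => A.Nonempty ∧ ∑ s ∈ A, wt s = 0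

lemma mem_zeroSumBlocks {α : Type*} {wt : α → ℝ} {A B : Finset α} :
    A ∈ zeroSumBlocks wt B ↔ A ⊆ B ∧ A.Nonempty ∧ ∑ s ∈ A, wt s = 0 := by
  simp [zeroSumBlocks]

open Classical in
/-- First-return recursion for nonnegative permutations. -/
lemma numNonneg_eq_sum {α : Type*} (wt : α → ℝ) {B : Finset α} (hB : B.Nonempty)
    (hs : ∑ s ∈ B, wt s = 0) :
    numNonneg wt B = ∑ A ∈ zeroSumBlocks wt B, numPos wt A * numNonneg wt (B \ A) := by
  simp only [numPos_eq, numNonneg_eq, ← Finset.card_product]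
  rw [← Finset.card_sigma]
  symm
  refine Finset.card_bij (fun x _ => x.2.1 ++ x.2.2) ?_ ?_ ?_
  · rintro ⟨A, l₁, l₂⟩ h
    simp only [Finset.mem_sigma, mem_zeroSumBlocks, Finset.mem_product, Finset.mem_filter] at h
    obtain ⟨⟨hA, -, hA0⟩, ⟨h₁, hp⟩, h₂, hn⟩ := h
    have hs₁ := sum_map_of_mem_orderings wt h₁
    rw [mem_orderings] at h₁ h₂
    rw [Finset.mem_filter, mem_orderings]
    refine ⟨⟨?_, ?_⟩, NonnegList.append hp (hs₁.trans hA0) hn⟩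
    · refine h₁.1.append h₂.1 ?_
      rw [← List.disjoint_toFinset_iff_disjoint, h₁.2, h₂.2]
      exact Finset.disjoint_sdiff
    · rw [List.toFinset_append, h₁.2, h₂.2, Finset.union_sdiff_of_subset hA]
  · rintro ⟨A, l₁, l₂⟩ h ⟨A', m₁, m₂⟩ h' heq
    simp only [Finset.mem_sigma, mem_zeroSumBlocks, Finset.mem_product, Finset.mem_filter] at h h'
    obtain ⟨⟨-, hne, hA0⟩, ⟨h₁, hp⟩, -⟩ := h
    obtain ⟨⟨-, hne', hA0'⟩, ⟨h₁', hp'⟩, -⟩ := h'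
    have hs₁ := (sum_map_of_mem_orderings wt h₁).trans hA0
    have hs₁' := (sum_map_of_mem_orderings wt h₁').trans hA0'
    obtain ⟨-, rfl⟩ := mem_orderings.1 h₁
    obtain ⟨-, rfl⟩ := mem_orderings.1 h₁'
    rw [List.toFinset_nonempty_iff] at hne hne'
    obtain ⟨rfl, rfl⟩ := List.append_inj heq
      (le_antisymm (hp.length_le_of_append_eq hne' hs₁' heq)
        (hp'.length_le_of_append_eq hne hs₁ heq.symm))
    rfl
  · intro l hl
    rw [Finset.mem_filter] at hl
    have hs₀ := (sum_map_of_mem_orderings wt hl.1).trans hs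
    obtain ⟨hnd, rfl⟩ := mem_orderings.1 hl.1
    obtain ⟨l₁, l₂, rfl, hne, hs₁, hp, hn⟩ :=
      hl.2.exists_append (List.toFinset_nonempty_iff _ |>.1 hB) hs₀
    obtain ⟨hn₁, hn₂, hd⟩ := List.nodup_append'.1 hnd
    refine ⟨⟨l₁.toFinset, l₁, l₂⟩, ?_, rfl⟩
    have h₁ : l₁ ∈ orderings l₁.toFinset := mem_orderings.2 ⟨hn₁, rfl⟩
    simp only [Finset.mem_sigma, mem_zeroSumBlocks, Finset.mem_product, Finset.mem_filter]
    refine ⟨⟨?_, ?_, ?_⟩, ⟨h₁, hp⟩, mem_orderings.2 ⟨hn₂, ?_⟩, hn⟩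
    · rw [List.toFinset_append]
      exact Finset.subset_union_left
    · rwa [List.toFinset_nonempty_iff]
    · rw [← sum_map_of_mem_orderings wt h₁, hs₁]
    · rw [List.toFinset_append, Finset.union_sdiff_left]
      exact (Finset.sdiff_eq_self_of_disjoint
        (List.disjoint_toFinset_iff_disjoint.2 hd.symm)).symm

/-- An ordered tuple of pairwise disjoint nonempty zero-sum subsets with union `B`. -/
def OrderedTupleOn {α : Type*} (wt : α → ℝ) (B : Finset α) (n : ℕ) (f : Fin n → Finset α) :
    Prop :=
  (∀ i, (f i).Nonempty) ∧ (∀ i, ∑ s ∈ f i, wt s = 0) ∧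
  (∀ i j, i ≠ j → Disjoint (f i) (f j)) ∧ (∀ a : α, a ∈ B ↔ ∃ i, a ∈ f i)

open Classical in
lemma orderedTupleOn_cons {α : Type*} {wt : α → ℝ} {B A : Finset α} {n : ℕ}
    {f : Fin n → Finset α} :
    OrderedTupleOn wt B (n + 1) (Fin.cons A f) ↔
      A ∈ zeroSumBlocks wt B ∧ OrderedTupleOn wt (B \ A) n f := by
  simp only [OrderedTupleOn, mem_zeroSumBlocks, Fin.forall_fin_succ, Fin.exists_fin_succ,
    Fin.cons_zero, Fin.cons_succ, Finset.mem_sdiff, ne_eq, not_true_eq_false, false_imp_iff,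
    true_and, Fin.succ_ne_zero, (Fin.succ_ne_zero _).symm, not_false_eq_true, true_imp_iff,
    Fin.succ_inj, Finset.disjoint_left]
  constructor
  · rintro ⟨⟨h1, h2⟩, ⟨h3, h4⟩, ⟨h5, h6⟩, h7⟩
    refine ⟨⟨fun a ha => (h7 a).2 (Or.inl ha), h1, h3⟩, h2, h4, fun i => (h6 i).2, fun a => ?_⟩
    rw [h7 a]
    constructor
    · rintro ⟨h | h, h'⟩
      exacts [absurd h h', h]
    · rintro ⟨i, hi⟩
      exact ⟨Or.inr ⟨i, hi⟩, fun h => h5 i h hi⟩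
  · rintro ⟨⟨h1, h2, h3⟩, h4, h5, h6, h7⟩
    refine ⟨⟨h2, h4⟩, ⟨h3, h5⟩, ⟨fun i a ha hi => ((h7 a).2 ⟨i, hi⟩).2 ha,
      fun i => ⟨fun a hi ha => ((h7 a).2 ⟨i, hi⟩).2 ha, h6 i⟩⟩, fun a => ?_⟩
    rw [← h7 a]
    constructor
    · intro h
      by_cases ha : a ∈ A
      exacts [Or.inl ha, Or.inr ⟨h, ha⟩]
    · rintro (h | h)
      exacts [h1 h, h.1]

open Classical in
/-- The contribution to the sum over ordered tuples of those of length `n` with union `B`. -/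
noncomputable def tupleSum {α : Type*} [Fintype α] (wt : α → ℝ) (n : ℕ) (B : Finset α) : ℕ :=
  ∑ f ∈ Finset.univ.filter (OrderedTupleOn wt B n), ∏ i, numPos wt (f i)

open Classical in
lemma tupleSum_zero {α : Type*} [Fintype α] (wt : α → ℝ) (B : Finset α) :
    tupleSum wt 0 B = if B = ∅ then 1 else 0 := by
  have h : ∀ f : Fin 0 → Finset α, OrderedTupleOn wt B 0 f ↔ B = ∅ := fun f => by
    simp [OrderedTupleOn, Finset.eq_empty_iff_forall_notMem]
  split_ifs with hB <;> simp only [tupleSum, h] <;> simp [hB]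

open Classical in
lemma tupleSum_succ {α : Type*} [Fintype α] (wt : α → ℝ) (n : ℕ) (B : Finset α) :
    tupleSum wt (n + 1) B =
      ∑ A ∈ zeroSumBlocks wt B, numPos wt A * tupleSum wt n (B \ A) := by
  simp only [tupleSum, Finset.mul_sum]
  rw [Finset.sum_sigma']
  symm
  refine Finset.sum_bij (fun x _ => (Fin.cons x.1 x.2 : Fin (n + 1) → Finset α)) ?_ ?_ ?_ ?_
  · rintro ⟨A, f⟩ h
    simpa [orderedTupleOn_cons] using h
  · rintro ⟨A, f⟩ - ⟨A', f'⟩ - h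
    obtain ⟨rfl, rfl⟩ := Fin.cons_inj.1 h
    rfl
  · intro g hg
    refine ⟨⟨g 0, Fin.tail g⟩, ?_, Fin.cons_self_tail g⟩
    rw [← Fin.cons_self_tail g] at hg
    simpa only [Finset.mem_filter, Finset.mem_univ, true_and, orderedTupleOn_cons,
      Finset.mem_sigma] using hg
  · rintro ⟨A, f⟩ -
    simp [Fin.prod_univ_succ]

lemma numNonneg_eq_sum_tupleSum {α : Type*} [Fintype α] (wt : α → ℝ) (m : ℕ) (B : Finset α)
    (hs : ∑ s ∈ B, wt s = 0) (hm : B.card < m) :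
    numNonneg wt B = ∑ n ∈ Finset.range m, tupleSum wt n B := by
  classical
  induction m generalizing B with
  | zero => omega
  | succ m ih =>
    rw [Finset.sum_range_succ', tupleSum_zero]
    simp only [tupleSum_succ]
    rw [Finset.sum_comm]
    rcases B.eq_empty_or_nonempty with rfl | hB
    · rw [numNonneg_empty, if_pos rfl, Finset.sum_eq_zero]
      intro A hA
      obtain ⟨hA, hne, -⟩ := mem_zeroSumBlocks.1 hA
      exact absurd (Finset.subset_empty.1 hA) hne.ne_empty
    · rw [numNonneg_eq_sum wt hB hs, if_neg hB.ne_empty, add_zero]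
      refine Finset.sum_congr rfl fun A hA => ?_
      obtain ⟨hA, hne, hA0⟩ := mem_zeroSumBlocks.1 hA
      rw [← Finset.mul_sum, ← ih]
      · have := Finset.sum_sdiff (f := wt) hA
        linarith
      · have := Finset.card_sdiff_add_card_eq_card hA
        have := hne.card_pos
        omega

open Classical in
theorem stmt_18 {α : Type*} [Fintype α] (wt : α → ℝ)
    (hwt : ∀ s, wt s ≠ 0) (hsum : ∑ s, wt s = 0) (hcard : 2 ≤ Fintype.card α) :
    numNonneg wt Finset.univ =
      ∑ n ∈ Finset.range (Fintype.card α + 1),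
        ∑ f ∈ Finset.univ.filter (OrderedTuple wt n),
          ∏ i, numPos wt (f i) := by
  rw [numNonneg_eq_sum_tupleSum wt _ Finset.univ hsum (Nat.lt_succ_self _)]
  refine Finset.sum_congr (by simp) fun n _ => ?_
  have h : OrderedTupleOn wt Finset.univ n = OrderedTuple wt n := by
    funext f
    simp [OrderedTupleOn, OrderedTuple]
  simp only [tupleSum, h]
end

section
/- For any full passport (S, wt), the number of non-negative permutations satisfies |P_{≥0}| = Σ_{𝔭 ∈ 𝔓} X(𝔭), where the sum ranges over all partitions of S into nonempty zero-sum blocks. -/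
open Finset

section Convolution

variable {α : Type*}

open Classical in
/-- The set convolution `∑_{A ⊆ B} X A * Y (B \ A)`. -/
noncomputable def setConv (X Y : Finset α → ℤ) (B : Finset α) : ℤ :=
  ∑ A ∈ B.powerset, X A * Y (B \ A)

lemma setConv_comm (X Y : Finset α → ℤ) (B : Finset α) : setConv X Y B = setConv Y X B := by
  classical
  unfold setConv
  refine Finset.sum_nbij' (fun A => B \ A) (fun A => B \ A) ?_ ?_ ?_ ?_ ?_
  · intro A _; simp
  · intro A _; simp
  · intro A hA; simpa using hA
  · intro A hA; simpa using hA
  · intro A hA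
    simp only [Finset.mem_powerset] at hA
    simp only [Finset.sdiff_sdiff_eq_self hA, mul_comm]

open Classical in
lemma sum_setConv_erase (X Y : Finset α → ℤ) (B : Finset α) :
    ∑ b ∈ B, setConv X Y (B.erase b) =
      ∑ A ∈ B.powerset, X A * ∑ b ∈ B \ A, Y ((B \ A).erase b) := by
  simp only [setConv, Finset.mul_sum]
  rw [Finset.sum_comm' (t' := B.powerset) (s' := fun A => B \ A)]
  · refine Finset.sum_congr rfl fun A _ => Finset.sum_congr rfl fun b _ => ?_
    rw [Finset.erase_sdiff_comm]
  · intro b A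
    simp only [Finset.mem_powerset, Finset.mem_sdiff, Finset.subset_erase]
    tauto

end Convolution

section Orderings

variable {α : Type*}

open Classical in
/-- The number of orderings of `B` all of whose nonempty initial segments satisfy `c`. -/
noncomputable def orderCount (c : Finset α → Prop) (B : Finset α) : ℤ :=
  if B = ∅ then 1 else if c B then ∑ b : B, orderCount c (B.erase b) else 0
termination_by B.card
decreasing_by exact Finset.card_erase_lt_of_mem b.2

lemma orderCount_empty (c : Finset α → Prop) : orderCount c ∅ = 1 := by
  rw [orderCount]; simp

open Classical in
lemma orderCount_of_nonempty (c : Finset α → Prop) {B : Finset α} (hB : B.Nonempty) :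
    orderCount c B = if c B then ∑ b ∈ B, orderCount c (B.erase b) else 0 := by
  rw [orderCount, if_neg hB.ne_empty]
  congr 1
  exact Finset.sum_coe_sort B (fun b => orderCount c (B.erase b))

lemma eq_empty_or_of_orderCount_ne_zero {c : Finset α → Prop} {B : Finset α}
    (h : orderCount c B ≠ 0) : B = ∅ ∨ c B := by
  classical
  rcases B.eq_empty_or_nonempty with hB | hB
  · exact Or.inl hB
  · rw [orderCount_of_nonempty c hB] at h
    by_contra! hc
    simp [hc.2] at h

/-- Splitting an ordering at its first minimum of the cumulative sums. -/
lemma setConv_orderCount (wt : α → ℝ) (B : Finset α) :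
    setConv (orderCount fun C => ∑ s ∈ C, wt s < 0) (orderCount fun C => 0 ≤ ∑ s ∈ C, wt s) B
      = (B.card.factorial : ℤ) := by
  classical
  induction B using Finset.strongInduction with
  | H B ih =>
  rcases B.eq_empty_or_nonempty with rfl | hB
  · simp [setConv, orderCount_empty]
  set G := orderCount fun C => ∑ s ∈ C, wt s < 0 with hG
  set F := orderCount fun C => 0 ≤ ∑ s ∈ C, wt s with hF
  have hsum : ∑ b ∈ B, setConv G F (B.erase b) = (B.card.factorial : ℤ) := by
    rw [Finset.sum_congr rfl fun b hb => ih (B.erase b) (Finset.erase_ssubset hb)]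
    rw [Finset.sum_congr rfl fun b hb => by rw [Finset.card_erase_of_mem hb]]
    rw [Finset.sum_const, nsmul_eq_mul]
    exact_mod_cast Nat.mul_factorial_pred hB.card_pos.ne'
  rcases le_or_gt 0 (∑ s ∈ B, wt s) with hs | hs
  · rw [← hsum, sum_setConv_erase, setConv]
    refine Finset.sum_congr rfl fun A hA => ?_
    rw [Finset.mem_powerset] at hA
    by_cases hGA : G A = 0
    · simp [hGA]
    have hadd := Finset.sum_sdiff hA (f := wt)
    have hA' : A ≠ B ∧ 0 ≤ ∑ s ∈ B \ A, wt s := by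
      rcases eq_empty_or_of_orderCount_ne_zero hGA with rfl | h
      · exact ⟨hB.ne_empty.symm, by simpa using hs⟩
      · exact ⟨by rintro rfl; linarith, by linarith⟩
    have hne : (B \ A).Nonempty :=
      Finset.sdiff_nonempty.2 fun h => hA'.1 (Finset.Subset.antisymm hA h)
    rw [hF, orderCount_of_nonempty _ hne, if_pos hA'.2]
  · rw [← hsum, Finset.sum_congr rfl fun b _ => setConv_comm G F (B.erase b), sum_setConv_erase,
      setConv_comm, setConv]
    refine Finset.sum_congr rfl fun A hA => ?_
    rw [Finset.mem_powerset] at hA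
    by_cases hFA : F A = 0
    · simp [hFA]
    have hadd := Finset.sum_sdiff hA (f := wt)
    have hA' : A ≠ B ∧ ∑ s ∈ B \ A, wt s < 0 := by
      rcases eq_empty_or_of_orderCount_ne_zero hFA with rfl | h
      · exact ⟨hB.ne_empty.symm, by simpa using hs⟩
      · exact ⟨by rintro rfl; linarith, by linarith⟩
    have hne : (B \ A).Nonempty :=
      Finset.sdiff_nonempty.2 fun h => hA'.1 (Finset.Subset.antisymm hA h)
    rw [hG, orderCount_of_nonempty _ hne, if_pos hA'.2]

/-- `p` lists the elements of `B` without repetition, with nonnegative cumulative sums. -/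
def IsNonnegListing (wt : α → ℝ) (n : ℕ) (B : Finset α) (p : Fin n → α) : Prop :=
  Function.Injective p ∧ (∀ a, a ∈ B ↔ ∃ j, p j = a) ∧
    ∀ i ≤ n, 0 ≤ ∑ j ∈ Finset.univ.filter (fun j : Fin n => (j : ℕ) < i), wt (p j)

lemma sum_comp_eq_sum {wt : α → ℝ} {n : ℕ} {B : Finset α} {p : Fin n → α}
    (hp : Function.Injective p) (hB : ∀ a, a ∈ B ↔ ∃ j, p j = a) :
    ∑ j, wt (p j) = ∑ s ∈ B, wt s := by
  classical
  have : B = Finset.univ.image p := by ext a; simp [hB]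
  rw [this, Finset.sum_image fun _ _ _ _ h => hp h]

lemma sum_snoc_lt (wt : α → ℝ) {n : ℕ} (p : Fin n → α) (b : α) {i : ℕ} (hi : i ≤ n) :
    ∑ j ∈ Finset.univ.filter (fun j : Fin (n + 1) => (j : ℕ) < i),
        wt (Fin.snoc (α := fun _ => α) p b j) =
      ∑ j ∈ Finset.univ.filter (fun j : Fin n => (j : ℕ) < i), wt (p j) := by
  rw [Finset.sum_filter, Finset.sum_filter, Fin.sum_univ_castSucc]
  simp [hi.not_gt]

open Classical in
lemma isNonnegListing_snoc (wt : α → ℝ) (n : ℕ) (B : Finset α) (p : Fin n → α) (b : α) :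
    IsNonnegListing wt (n + 1) B (Fin.snoc (α := fun _ => α) p b) ↔
      (b ∈ B ∧ 0 ≤ ∑ s ∈ B, wt s) ∧ IsNonnegListing wt n (B.erase b) p := by
  have hmem : (∀ a, a ∈ B ↔ ∃ j, Fin.snoc (α := fun _ => α) p b j = a) ↔
      ∀ a, a ∈ B ↔ (∃ j, p j = a) ∨ b = a := by
    simp [Fin.exists_fin_succ', Fin.snoc_castSucc, Fin.snoc_last]
  have hinj : Function.Injective (Fin.snoc (α := fun _ => α) p b) ↔
      Function.Injective p ∧ ∀ j, p j ≠ b := by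
    rw [Fin.snoc_injective_iff]; simp
  have htot : ∑ j ∈ Finset.univ.filter (fun j : Fin (n + 1) => (j : ℕ) < n + 1),
      wt (Fin.snoc (α := fun _ => α) p b j) =
      ∑ j, wt (Fin.snoc (α := fun _ => α) p b j) := by
    rw [Finset.filter_true_of_mem fun j _ => j.2]
  constructor
  · rintro ⟨h1, h2, h3⟩
    have h4 := h3 (n + 1) le_rfl
    rw [htot, sum_comp_eq_sum h1 h2] at h4
    rw [hinj] at h1
    rw [hmem] at h2
    refine ⟨⟨(h2 b).2 (Or.inr rfl), h4⟩, h1.1, fun a => ?_, fun i hi => ?_⟩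
    · rw [Finset.mem_erase, h2]
      constructor
      · rintro ⟨h, h' | h'⟩
        · exact h'
        · exact absurd h'.symm h
      · rintro ⟨j, rfl⟩
        exact ⟨h1.2 j, Or.inl ⟨j, rfl⟩⟩
    · rw [← sum_snoc_lt wt p b hi]
      exact h3 i (by omega)
  · rintro ⟨⟨hb, hs⟩, h1, h2, h3⟩
    have hi : Function.Injective (Fin.snoc (α := fun _ => α) p b) :=
      hinj.2 ⟨h1, fun j => (Finset.mem_erase.1 ((h2 _).2 ⟨j, rfl⟩)).1⟩
    have hm : ∀ a, a ∈ B ↔ ∃ j, Fin.snoc (α := fun _ => α) p b j = a := by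
      rw [hmem]
      intro a
      rw [← h2, Finset.mem_erase]
      by_cases hab : b = a
      · simp [← hab, hb]
      · simp [hab, Ne.symm hab]
    refine ⟨hi, hm, fun i hin => ?_⟩
    rcases hin.lt_or_eq with h | rfl
    · rw [sum_snoc_lt wt p b (by omega)]
      exact h3 i (by omega)
    · rw [htot, sum_comp_eq_sum hi hm]
      exact hs

open Classical in
lemma card_isNonnegListing [Fintype α] (wt : α → ℝ) (n : ℕ) (B : Finset α) (hB : B.card = n) :
    ((Finset.univ.filter (IsNonnegListing wt n B)).card : ℤ) =
      orderCount (fun C => 0 ≤ ∑ s ∈ C, wt s) B := by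
  induction n generalizing B with
  | zero =>
    obtain rfl := Finset.card_eq_zero.1 hB
    rw [orderCount_empty, Finset.filter_true_of_mem]
    · simp
    · intro p _
      exact ⟨Function.injective_of_subsingleton p, by simp, by simp⟩
  | succ n ih =>
    have hne : B.Nonempty := Finset.card_pos.1 (by omega)
    rw [orderCount_of_nonempty _ hne, Finset.card_filter, Nat.cast_sum,
      ← (Fin.snocEquiv (fun _ : Fin (n + 1) => α)).sum_comp, Fintype.sum_prod_type]
    have key : ∀ b : α, ∑ p : Fin n → α,
        (((if IsNonnegListing wt (n + 1) B
          (Fin.snocEquiv (fun _ : Fin (n + 1) => α) (b, p)) then 1 else 0 : ℕ)) : ℤ) =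
        if b ∈ B then (if 0 ≤ ∑ s ∈ B, wt s then
          orderCount (fun C => 0 ≤ ∑ s ∈ C, wt s) (B.erase b) else 0) else 0 := by
      intro b
      have : ∀ p : Fin n → α, (Fin.snocEquiv (fun _ : Fin (n + 1) => α) (b, p)) =
        Fin.snoc (α := fun _ => α) p b := fun p => rfl
      simp only [this, isNonnegListing_snoc]
      by_cases hb : b ∈ B
      · by_cases hs : 0 ≤ ∑ s ∈ B, wt s
        · rw [if_pos hb, if_pos hs, ← ih (B.erase b) (by rw [Finset.card_erase_of_mem hb, hB]; rfl),
            Finset.card_filter, Nat.cast_sum]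
          simp [hb, hs]
        · simp [hs]
      · simp [hb]
    refine (Finset.sum_congr rfl fun b _ => key b).trans ?_
    rw [← Finset.sum_filter, Finset.filter_univ_mem]
    split_ifs <;> simp

lemma numNonneg_eq_orderCount [Fintype α] (wt : α → ℝ) (B : Finset α)
    (hB : ∑ s ∈ B, wt s = 0) :
    (numNonneg wt B : ℤ) = orderCount (fun C => 0 ≤ ∑ s ∈ C, wt s) B := by
  classical
  rw [← card_isNonnegListing wt B.card B rfl, numNonneg, ← Fintype.card_subtype,
    ← Nat.card_eq_fintype_card]
  congr 1
  have hmem : ∀ P : Fin B.card ≃ {x // x ∈ B}, ∀ a, a ∈ B ↔ ∃ j, (P j : α) = a := by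
    intro P a
    constructor
    · intro ha
      exact ⟨P.symm ⟨a, ha⟩, by simp⟩
    · rintro ⟨j, rfl⟩
      exact (P j).2
  have hinj : ∀ P : Fin B.card ≃ {x // x ∈ B}, Function.Injective fun j => (P j : α) :=
    fun P => Subtype.val_injective.comp P.injective
  refine Nat.card_eq_of_bijective
    (fun P => ⟨fun j => (P.1 j : α), hinj P.1, hmem P.1, fun i hi => ?_⟩) ⟨?_, ?_⟩
  · rcases Nat.eq_zero_or_pos i with rfl | h0
    · simp
    rcases hi.lt_or_eq with h | rfl
    · exact P.2 i h0 (by omega)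
    · rw [Finset.filter_true_of_mem fun j _ => j.2,
        sum_comp_eq_sum (hinj P.1) (hmem P.1), hB]
  · intro P Q h
    apply Subtype.ext
    ext j
    exact congrFun (congrArg Subtype.val h) j
  · rintro ⟨p, h1, h2, h3⟩
    refine ⟨⟨Equiv.ofBijective (fun j => ⟨p j, (h2 _).2 ⟨j, rfl⟩⟩) ⟨?_, ?_⟩, ?_⟩, rfl⟩
    · intro i j h
      exact h1 (congrArg Subtype.val h)
    · rintro ⟨a, ha⟩
      obtain ⟨j, hj⟩ := (h2 a).1 ha
      exact ⟨j, Subtype.ext hj⟩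
    · intro i _ hi
      exact h3 i (by omega)

end Orderings

section Partitions

variable {α : Type*} [Fintype α]

open Classical in
/-- The sum of `∏ u C` over all partitions of `B`. -/
noncomputable def partSum (u : Finset α → ℤ) (B : Finset α) : ℤ :=
  ∑ 𝔭 ∈ Finset.univ.filter (IsPart (fun _ => (0 : ℝ)) B), ∏ C ∈ 𝔭, u C

lemma partSum_empty (u : Finset α → ℤ) : partSum u ∅ = 1 := by
  classical
  have : Finset.univ.filter (IsPart (fun _ : α => (0 : ℝ)) ∅) = {∅} := by
    ext 𝔭
    simp only [Finset.mem_filter, Finset.mem_univ, true_and, Finset.mem_singleton]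
    constructor
    · rintro ⟨h1, h2, -, -⟩
      refine Finset.eq_empty_of_forall_notMem fun B hB => ?_
      exact (h1 B hB).ne_empty (Finset.subset_empty.1 (h2 B hB))
    · rintro rfl
      simp [IsPart]
  rw [partSum, this]
  simp

open Classical in
lemma partSum_eq_sum_block (u : Finset α → ℤ) {B : Finset α} {a : α} (ha : a ∈ B) :
    partSum u B = ∑ C ∈ B.powerset with a ∈ C, u C * partSum u (B \ C) := by
  simp only [partSum, Finset.mul_sum]
  rw [Finset.sum_sigma']
  symm
  have hnot : ∀ C 𝔮, a ∈ C → IsPart (fun _ : α => (0 : ℝ)) (B \ C) 𝔮 → ∀ D ∈ 𝔮, a ∉ D := by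
    intro C 𝔮 haC h D hD haD
    exact (Finset.mem_sdiff.1 (h.2.1 D hD haD)).2 haC
  refine Finset.sum_bij (fun x _ => insert x.1 x.2) ?_ ?_ ?_ ?_
  · rintro ⟨C, 𝔮⟩ hx
    simp only [Finset.mem_sigma, Finset.mem_filter, Finset.mem_powerset, Finset.mem_univ,
      true_and] at hx ⊢
    obtain ⟨⟨hCB, haC⟩, h1, h2, h3, -⟩ := hx
    refine ⟨?_, ?_, ?_, by simp⟩
    · intro D hD
      rcases Finset.mem_insert.1 hD with rfl | hD
      · exact ⟨a, haC⟩
      · exact h1 D hD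
    · intro D hD
      rcases Finset.mem_insert.1 hD with rfl | hD
      · exact hCB
      · exact (h2 D hD).trans Finset.sdiff_subset
    · intro x hx
      by_cases hxC : x ∈ C
      · refine ⟨C, ⟨Finset.mem_insert_self _ _, hxC⟩, ?_⟩
        rintro D ⟨hD, hxD⟩
        rcases Finset.mem_insert.1 hD with rfl | hD
        · rfl
        · exact absurd hxC (Finset.mem_sdiff.1 (h2 D hD hxD)).2
      · obtain ⟨D, ⟨hD, hxD⟩, huniq⟩ := h3 x (Finset.mem_sdiff.2 ⟨hx, hxC⟩)
        refine ⟨D, ⟨Finset.mem_insert_of_mem hD, hxD⟩, ?_⟩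
        rintro E ⟨hE, hxE⟩
        rcases Finset.mem_insert.1 hE with rfl | hE
        · exact absurd hxE hxC
        · exact huniq E ⟨hE, hxE⟩
  · rintro ⟨C, 𝔮⟩ hx ⟨C', 𝔮'⟩ hx' heq
    simp only [Finset.mem_sigma, Finset.mem_filter, Finset.mem_powerset, Finset.mem_univ,
      true_and] at hx hx' heq
    have hn := hnot C 𝔮 hx.1.2 hx.2
    have hn' := hnot C' 𝔮' hx'.1.2 hx'.2
    have hCC : C = C' := by
      have : C ∈ insert C' 𝔮' := heq ▸ Finset.mem_insert_self C 𝔮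
      rcases Finset.mem_insert.1 this with h | h
      · exact h
      · exact absurd hx.1.2 (hn' C h)
    subst hCC
    have hq : 𝔮 = 𝔮' := by
      rw [← Finset.erase_insert (fun h => hn C h hx.1.2), heq,
        Finset.erase_insert (fun h => hn' C h hx.1.2)]
    rw [hq]
  · intro 𝔭 h𝔭
    simp only [Finset.mem_filter, Finset.mem_univ, true_and] at h𝔭
    obtain ⟨h1, h2, h3, -⟩ := h𝔭
    obtain ⟨C, ⟨hC, haC⟩, -⟩ := h3 a ha
    refine ⟨⟨C, 𝔭.erase C⟩, ?_, Finset.insert_erase hC⟩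
    simp only [Finset.mem_sigma, Finset.mem_filter, Finset.mem_powerset, Finset.mem_univ,
      true_and]
    refine ⟨⟨h2 C hC, haC⟩, fun D hD => h1 D (Finset.mem_of_mem_erase hD), ?_, ?_, by simp⟩
    · intro D hD x hx
      obtain ⟨hDC, hD⟩ := Finset.mem_erase.1 hD
      refine Finset.mem_sdiff.2 ⟨h2 D hD hx, fun hxC => hDC ?_⟩
      exact (h3 x (h2 D hD hx)).unique ⟨hD, hx⟩ ⟨hC, hxC⟩
    · intro x hx
      obtain ⟨hxB, hxC⟩ := Finset.mem_sdiff.1 hx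
      obtain ⟨D, ⟨hD, hxD⟩, huniq⟩ := h3 x hxB
      refine ⟨D, ⟨Finset.mem_erase.2 ⟨?_, hD⟩, hxD⟩, ?_⟩
      · rintro rfl; exact hxC hxD
      · rintro E ⟨hE, hxE⟩
        exact huniq E ⟨Finset.mem_of_mem_erase hE, hxE⟩
  · rintro ⟨C, 𝔮⟩ hx
    simp only [Finset.mem_sigma, Finset.mem_filter, Finset.mem_powerset, Finset.mem_univ,
      true_and] at hx
    exact (Finset.prod_insert fun h => hnot C 𝔮 hx.1.2 hx.2 C h hx.1.2).symm

open Classical in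
lemma eq_empty_or_of_partSum_ne_zero {u : Finset α → ℤ} {c : Finset α → Prop}
    (hu : ∀ C, u C ≠ 0 → c C) (hc : ∀ A B, A ⊆ B → c A → c (B \ A) → c B)
    (B : Finset α) (h : partSum u B ≠ 0) : B = ∅ ∨ c B := by
  classical
  induction B using Finset.strongInduction with
  | H B ih =>
  rcases B.eq_empty_or_nonempty with hB | ⟨a, ha⟩
  · exact Or.inl hB
  right
  rw [partSum_eq_sum_block u ha] at h
  obtain ⟨C, hC, hne⟩ := Finset.exists_ne_zero_of_sum_ne_zero h
  simp only [Finset.mem_filter, Finset.mem_powerset] at hC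
  have hcC := hu C (left_ne_zero_of_mul hne)
  rcases ih (B \ C) (Finset.sdiff_ssubset hC.1 ⟨a, hC.2⟩) (right_ne_zero_of_mul hne) with h0 | h1
  · rwa [Finset.Subset.antisymm (Finset.sdiff_eq_empty_iff_subset.1 h0) hC.1]
  · exact hc C B hC.1 hcC h1

open Classical in
lemma sum_partSum_mul_eq_sum_setConv (u Y : Finset α → ℤ) (B : Finset α) (a : α) :
    ∑ A ∈ B.powerset with a ∈ A, partSum u A * Y (B \ A) =
      ∑ C ∈ B.powerset with a ∈ C, u C * setConv (partSum u) Y (B \ C) := by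
  have h1 : ∑ A ∈ B.powerset with a ∈ A, partSum u A * Y (B \ A) =
      ∑ A ∈ B.powerset with a ∈ A, ∑ C ∈ A.powerset with a ∈ C,
        u C * (partSum u (A \ C) * Y (B \ A)) := by
    refine Finset.sum_congr rfl fun A hA => ?_
    rw [partSum_eq_sum_block u (Finset.mem_filter.1 hA).2, Finset.sum_mul]
    exact Finset.sum_congr rfl fun C _ => mul_assoc _ _ _
  simp only [h1, setConv, Finset.mul_sum]
  rw [Finset.sum_sigma', Finset.sum_sigma']
  refine Finset.sum_nbij' (fun x => ⟨x.2, x.1 \ x.2⟩) (fun x => ⟨x.1 ∪ x.2, x.1⟩) ?_ ?_ ?_ ?_ ?_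
  · rintro ⟨A, C⟩ h
    simp only [Finset.mem_sigma, Finset.mem_filter, Finset.mem_powerset] at h ⊢
    exact ⟨⟨h.2.1.trans h.1.1, h.2.2⟩, Finset.sdiff_subset_sdiff h.1.1 subset_rfl⟩
  · rintro ⟨C, A⟩ h
    simp only [Finset.mem_sigma, Finset.mem_filter, Finset.mem_powerset] at h ⊢
    exact ⟨⟨Finset.union_subset h.1.1 (h.2.trans Finset.sdiff_subset),
      Finset.mem_union_left _ h.1.2⟩, Finset.subset_union_left, h.1.2⟩
  · rintro ⟨A, C⟩ h
    simp only [Finset.mem_sigma, Finset.mem_filter, Finset.mem_powerset] at h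
    simp only [Finset.union_sdiff_of_subset h.2.1]
  · rintro ⟨C, A⟩ h
    simp only [Finset.mem_sigma, Finset.mem_filter, Finset.mem_powerset] at h
    have : Disjoint C A := (Finset.subset_sdiff.1 h.2).2.symm
    simp only [Finset.union_sdiff_cancel_left this]
  · rintro ⟨A, C⟩ h
    simp only [Finset.mem_sigma, Finset.mem_filter, Finset.mem_powerset] at h
    have : (B \ C) \ (A \ C) = B \ A := by
      ext x
      simp only [Finset.mem_sdiff]
      have := @h.2.1 x
      tauto
    simp only [this]

lemma setConv_partSum (u v : Finset α → ℤ) (B : Finset α) :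
    setConv (partSum u) (partSum v) B = partSum (fun C => u C + v C) B := by
  classical
  induction B using Finset.strongInduction with
  | H B ih =>
  rcases B.eq_empty_or_nonempty with rfl | ⟨a, ha⟩
  · simp [setConv, partSum_empty]
  have hsplit : setConv (partSum u) (partSum v) B =
      ∑ A ∈ B.powerset with a ∈ A, partSum u A * partSum v (B \ A) +
        ∑ A ∈ B.powerset with a ∈ A, partSum v A * partSum u (B \ A) := by
    rw [setConv, ← Finset.sum_filter_add_sum_filter_not _ (fun A => a ∈ A)]
    congr 1
    refine Finset.sum_nbij' (fun A => B \ A) (fun A => B \ A) ?_ ?_ ?_ ?_ ?_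
    · intro A hA
      simp only [Finset.mem_filter, Finset.mem_powerset, Finset.mem_sdiff] at hA ⊢
      exact ⟨Finset.sdiff_subset, ha, hA.2⟩
    · intro A hA
      simp only [Finset.mem_filter, Finset.mem_powerset, Finset.mem_sdiff] at hA ⊢
      exact ⟨Finset.sdiff_subset, fun h => h.2 hA.2⟩
    · intro A hA
      exact Finset.sdiff_sdiff_eq_self (Finset.mem_powerset.1 (Finset.mem_filter.1 hA).1)
    · intro A hA
      exact Finset.sdiff_sdiff_eq_self (Finset.mem_powerset.1 (Finset.mem_filter.1 hA).1)
    · intro A hA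
      simp only [Finset.sdiff_sdiff_eq_self (Finset.mem_powerset.1 (Finset.mem_filter.1 hA).1),
        mul_comm]
  rw [hsplit, sum_partSum_mul_eq_sum_setConv, sum_partSum_mul_eq_sum_setConv,
    ← Finset.sum_add_distrib, partSum_eq_sum_block _ ha]
  refine Finset.sum_congr rfl fun C hC => ?_
  simp only [Finset.mem_filter, Finset.mem_powerset] at hC
  rw [setConv_comm (partSum v), ih (B \ C) (Finset.sdiff_ssubset hC.1 ⟨a, hC.2⟩), ← add_mul]

/-- Every permutation of `B` decomposes into cycles. -/
lemma partSum_factorial (B : Finset α) :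
    partSum (fun C => ((C.card - 1).factorial : ℤ)) B = (B.card.factorial : ℤ) := by
  classical
  induction B using Finset.strongInduction with
  | H B ih =>
  rcases B.eq_empty_or_nonempty with rfl | ⟨a, ha⟩
  · simp [partSum_empty]
  have hcard : (B.erase a).card + 1 = B.card := Finset.card_erase_add_one ha
  rw [partSum_eq_sum_block _ ha]
  have h1 : ∑ C ∈ B.powerset with a ∈ C, ((C.card - 1).factorial : ℤ) *
      partSum (fun C => ((C.card - 1).factorial : ℤ)) (B \ C) =
      ∑ A ∈ (B.erase a).powerset,
        ((A.card.factorial * ((B.erase a).card - A.card).factorial : ℕ) : ℤ) := by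
    refine Finset.sum_nbij' (fun C => C.erase a) (fun A => insert a A) ?_ ?_ ?_ ?_ ?_
    · intro C hC
      simp only [Finset.mem_filter, Finset.mem_powerset] at hC ⊢
      exact Finset.erase_subset_erase a hC.1
    · intro A hA
      simp only [Finset.mem_filter, Finset.mem_powerset] at hA ⊢
      exact ⟨Finset.insert_subset ha (hA.trans (Finset.erase_subset _ _)),
        Finset.mem_insert_self _ _⟩
    · intro C hC
      exact Finset.insert_erase (Finset.mem_filter.1 hC).2
    · intro A hA
      exact Finset.erase_insert (Finset.subset_erase.1 (Finset.mem_powerset.1 hA)).2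
    · intro C hC
      simp only [Finset.mem_filter, Finset.mem_powerset] at hC
      rw [ih (B \ C) (Finset.sdiff_ssubset hC.1 ⟨a, hC.2⟩), Finset.card_sdiff_of_subset hC.1,
        Finset.card_erase_of_mem hC.2, Nat.cast_mul]
      have : 0 < C.card := Finset.card_pos.2 ⟨a, hC.2⟩
      congr 3
      omega
  rw [h1, ← Nat.cast_sum, Finset.sum_powerset_apply_card
    (fun m => m.factorial * ((B.erase a).card - m).factorial)]
  have h2 : ∀ m ∈ Finset.range ((B.erase a).card + 1), (B.erase a).card.choose m •
      (m.factorial * ((B.erase a).card - m).factorial) = (B.erase a).card.factorial := by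
    intro m hm
    rw [smul_eq_mul, ← mul_assoc]
    exact Nat.choose_mul_factorial_mul_factorial (Nat.lt_succ_iff.1 (Finset.mem_range.1 hm))
  rw [Finset.sum_congr rfl h2, Finset.sum_const, Finset.card_range, smul_eq_mul, ← hcard,
    Nat.factorial_succ]

end Partitions

section Comparison

variable {α : Type*}

open Classical in
/-- The cycle weight `(|C| - 1)!`, restricted to the sets satisfying `c`. -/
noncomputable def cycleWeight (c : Finset α → Prop) (C : Finset α) : ℤ :=
  if c C then ((C.card - 1).factorial : ℤ) else 0

lemma of_cycleWeight_ne_zero {c : Finset α → Prop} {C : Finset α} (h : cycleWeight c C ≠ 0) :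
    c C := by
  by_contra hc
  simp [cycleWeight, hc] at h

/-- A set version of the Sparre Andersen identity: orderings with cumulative sums of one sign are
equinumerous with permutations whose cycles have sums of that sign. -/
lemma orderCount_eq_partSum [Fintype α] (wt : α → ℝ) (B : Finset α) :
    orderCount (fun C => ∑ s ∈ C, wt s < 0) B =
        partSum (cycleWeight fun C => ∑ s ∈ C, wt s < 0) B ∧
      orderCount (fun C => 0 ≤ ∑ s ∈ C, wt s) B =
        partSum (cycleWeight fun C => 0 ≤ ∑ s ∈ C, wt s) B := by
  classical
  induction B using Finset.strongInduction with
  | H B ih =>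
  rcases B.eq_empty_or_nonempty with rfl | hB
  · simp [orderCount_empty, partSum_empty]
  have hconv : setConv (orderCount fun C => ∑ s ∈ C, wt s < 0)
        (orderCount fun C => 0 ≤ ∑ s ∈ C, wt s) B =
      setConv (partSum (cycleWeight fun C => ∑ s ∈ C, wt s < 0))
        (partSum (cycleWeight fun C => 0 ≤ ∑ s ∈ C, wt s)) B := by
    rw [setConv_orderCount, setConv_partSum, ← partSum_factorial]
    congr 1
    ext C
    rcases lt_or_ge (∑ s ∈ C, wt s) 0 with h | h
    · simp [cycleWeight, h, h.not_ge]
    · simp [cycleWeight, h, h.not_gt]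
  have hgneg : partSum (cycleWeight fun C => ∑ s ∈ C, wt s < 0) B ≠ 0 →
      ∑ s ∈ B, wt s < 0 := fun h =>
    (eq_empty_or_of_partSum_ne_zero (fun _ => of_cycleWeight_ne_zero)
      (fun A D hAD h1 h2 => by
        have := Finset.sum_sdiff hAD (f := wt)
        linarith) B h).resolve_left hB.ne_empty
  have hfnonneg : partSum (cycleWeight fun C => 0 ≤ ∑ s ∈ C, wt s) B ≠ 0 →
      0 ≤ ∑ s ∈ B, wt s := fun h =>
    (eq_empty_or_of_partSum_ne_zero (c := fun C => 0 ≤ ∑ s ∈ C, wt s)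
      (fun _ => of_cycleWeight_ne_zero)
      (fun A D hAD h1 h2 => by
        have := Finset.sum_sdiff hAD (f := wt)
        linarith) B h).resolve_left hB.ne_empty
  have hGneg : orderCount (fun C => ∑ s ∈ C, wt s < 0) B ≠ 0 → ∑ s ∈ B, wt s < 0 := fun h =>
    (eq_empty_or_of_orderCount_ne_zero h).resolve_left hB.ne_empty
  have hFnonneg : orderCount (fun C => 0 ≤ ∑ s ∈ C, wt s) B ≠ 0 → 0 ≤ ∑ s ∈ B, wt s := fun h =>
    (eq_empty_or_of_orderCount_ne_zero h).resolve_left hB.ne_empty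
  have hlt : ∀ A ⊆ B, A.Nonempty → B \ A ⊂ B := fun A hA hne => Finset.sdiff_ssubset hA hne
  unfold setConv at hconv
  rcases le_or_gt 0 (∑ s ∈ B, wt s) with hs | hs
  · have hneg : orderCount (fun C => ∑ s ∈ C, wt s < 0) B =
        partSum (cycleWeight fun C => ∑ s ∈ C, wt s < 0) B := by
      rw [not_not.1 (mt hGneg hs.not_gt), not_not.1 (mt hgneg hs.not_gt)]
    refine ⟨hneg, ?_⟩
    rw [← Finset.add_sum_erase _ _ (Finset.empty_mem_powerset B),
      ← Finset.add_sum_erase (a := ∅) _ _ (Finset.empty_mem_powerset B)] at hconv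
    have hterm : ∀ A ∈ B.powerset.erase ∅,
        orderCount (fun C => ∑ s ∈ C, wt s < 0) A *
            orderCount (fun C => 0 ≤ ∑ s ∈ C, wt s) (B \ A) =
          partSum (cycleWeight fun C => ∑ s ∈ C, wt s < 0) A *
            partSum (cycleWeight fun C => 0 ≤ ∑ s ∈ C, wt s) (B \ A) := by
      intro A hA
      simp only [Finset.mem_erase, Finset.mem_powerset] at hA
      rw [(ih (B \ A) (hlt A hA.2 (Finset.nonempty_iff_ne_empty.2 hA.1))).2]
      rcases eq_or_ne A B with rfl | hAB
      · rw [hneg]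
      · rw [(ih A (hA.2.ssubset_of_ne hAB)).1]
    rw [Finset.sum_congr rfl hterm] at hconv
    simpa [orderCount_empty, partSum_empty] using add_right_cancel hconv
  · have hpos : orderCount (fun C => 0 ≤ ∑ s ∈ C, wt s) B =
        partSum (cycleWeight fun C => 0 ≤ ∑ s ∈ C, wt s) B := by
      rw [not_not.1 (mt hFnonneg hs.not_ge), not_not.1 (mt hfnonneg hs.not_ge)]
    refine ⟨?_, hpos⟩
    rw [← Finset.add_sum_erase _ _ (Finset.mem_powerset_self B),
      ← Finset.add_sum_erase (a := B) _ _ (Finset.mem_powerset_self B)] at hconv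
    have hterm : ∀ A ∈ B.powerset.erase B,
        orderCount (fun C => ∑ s ∈ C, wt s < 0) A *
            orderCount (fun C => 0 ≤ ∑ s ∈ C, wt s) (B \ A) =
          partSum (cycleWeight fun C => ∑ s ∈ C, wt s < 0) A *
            partSum (cycleWeight fun C => 0 ≤ ∑ s ∈ C, wt s) (B \ A) := by
      intro A hA
      simp only [Finset.mem_erase, Finset.mem_powerset] at hA
      rw [(ih A (hA.2.ssubset_of_ne hA.1)).1]
      rcases A.eq_empty_or_nonempty with rfl | hne
      · rw [Finset.sdiff_empty, hpos]
      · rw [(ih (B \ A) (hlt A hA.2 hne)).2]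
    rw [Finset.sum_congr rfl hterm] at hconv
    simpa [orderCount_empty, partSum_empty] using add_right_cancel hconv

lemma IsPart.sum_sum {wt : α → ℝ} {S : Finset α} {𝔭 : Finset (Finset α)}
    (h : IsPart wt S 𝔭) (f : α → ℝ) : ∑ C ∈ 𝔭, ∑ s ∈ C, f s = ∑ s ∈ S, f s := by
  classical
  obtain ⟨-, h2, h3, -⟩ := h
  have hS : S = 𝔭.biUnion id := by
    ext x
    simp only [Finset.mem_biUnion, id]
    constructor
    · intro hx
      obtain ⟨C, hC, -⟩ := h3 x hx
      exact ⟨C, hC⟩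
    · rintro ⟨C, hC, hx⟩
      exact h2 C hC hx
  rw [hS, Finset.sum_biUnion]
  · rfl
  · intro C hC D hD hCD
    refine Finset.disjoint_left.2 fun x hxC hxD => hCD ?_
    exact (h3 x (h2 C hC hxC)).unique ⟨hC, hxC⟩ ⟨hD, hxD⟩

open Classical in
lemma partSum_nonneg_eq_sum_Xval [Fintype α] (wt : α → ℝ) (S : Finset α) (hS : ∑ s ∈ S, wt s = 0) :
    partSum (cycleWeight fun C => 0 ≤ ∑ s ∈ C, wt s) S =
      ((∑ 𝔭 ∈ Finset.univ.filter (IsPart wt S), Xval 𝔭 : ℕ) : ℤ) := by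
  rw [partSum, Nat.cast_sum]
  symm
  refine (Finset.sum_congr rfl fun 𝔭 h𝔭 => ?_).trans (Finset.sum_subset ?_ ?_)
  · rw [Xval, Nat.cast_prod]
    refine Finset.prod_congr rfl fun C hC => ?_
    have := (Finset.mem_filter.1 h𝔭).2.2.2.2 C hC
    rw [cycleWeight, if_pos this.ge]
  · intro 𝔭 h𝔭
    simp only [Finset.mem_filter, Finset.mem_univ, true_and] at h𝔭 ⊢
    exact ⟨h𝔭.1, h𝔭.2.1, h𝔭.2.2.1, by simp⟩
  · intro 𝔭 h𝔭 hn
    simp only [Finset.mem_filter, Finset.mem_univ, true_and] at h𝔭 hn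
    by_contra hne
    have hnn : ∀ C ∈ 𝔭, 0 ≤ ∑ s ∈ C, wt s := fun C hC =>
      of_cycleWeight_ne_zero (c := fun C => 0 ≤ ∑ s ∈ C, wt s) (Finset.prod_ne_zero_iff.1 hne C hC)
    refine hn ⟨h𝔭.1, h𝔭.2.1, h𝔭.2.2.1, ?_⟩
    exact (Finset.sum_eq_zero_iff_of_nonneg hnn).1 ((h𝔭.sum_sum wt).trans hS)

end Comparison

open Classical in
theorem stmt_19 {α : Type*} [Fintype α] (wt : α → ℝ)
    (hwt : ∀ s, wt s ≠ 0) (hsum : ∑ s, wt s = 0) (hcard : 2 ≤ Fintype.card α) :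
    numNonneg wt Finset.univ =
      ∑ 𝔭 ∈ Finset.univ.filter (IsPart wt Finset.univ), Xval 𝔭 := by
  have h := (orderCount_eq_partSum wt Finset.univ).2
  rw [← numNonneg_eq_orderCount wt _ hsum, partSum_nonneg_eq_sum_Xval wt _ hsum] at h
  exact_mod_cast h
end
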